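/- For every d ≥ 2 there exist positive constants C_d and β_d such that for every positive integer t and every integer N ≥ C_d · t^d there exists a spherical t-design X_N on S^d with N points satisfying the separation condition ‖x - y‖ ≥ β_d · N^{-1/d} for all distinct x, y ∈ X_N. -/

import Mathlib

open MeasureTheory

/-- The normalised surface area measure `σ_d` on the unit sphere `S^d ⊂ ℝ^{d+1}`. -/
noncomputable def sphereMeasure (d : ℕ) :
    Measure (EuclideanSpace ℝ (Fin (d + 1))) :=
  (μH[(d : ℝ)] (Metric.sphere (0 : EuclideanSpace ℝ (Fin (d + 1))) 1))⁻¹ •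
    (μH[(d : ℝ)]).restrict (Metric.sphere (0 : EuclideanSpace ℝ (Fin (d + 1))) 1)

/-- A finite set `X ⊂ S^d` is a spherical `t`-design if the equal-weight average over `X`
of every polynomial of total degree at most `t` equals its integral over `S^d`. -/
def IsSphericalDesign (d t : ℕ) (X : Finset (EuclideanSpace ℝ (Fin (d + 1)))) : Prop :=
  ∀ p : MvPolynomial (Fin (d + 1)) ℝ, p.totalDegree ≤ t →
    (X.card : ℝ)⁻¹ * ∑ x ∈ X, MvPolynomial.eval (fun i => x i) p =
      ∫ y, MvPolynomial.eval (fun i => y i) p ∂(sphereMeasure d)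

/-- Ambient Euclidean space. -/
abbrev Ed (d : ℕ) := EuclideanSpace ℝ (Fin (d + 1))

/-- Evaluation of a polynomial at a point. -/
noncomputable abbrev ev {d : ℕ} (p : MvPolynomial (Fin (d + 1)) ℝ) (x : Ed d) : ℝ :=
  MvPolynomial.eval (fun i => x i) p

open Polynomial in
lemma trig_rep_multiset {m : Type*} (a b : m → ℝ) (s : Multiset m) :
    ∃ q1 q2 : ℝ[X], q1.degree ≤ (s.card : ℕ) ∧ q2.degree < (s.card : ℕ) ∧ ∀ φ : ℝ,
      (s.map fun i => Real.cos φ * a i + Real.sin φ * b i).prod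
        = q1.eval (Real.cos φ) + Real.sin φ * q2.eval (Real.cos φ) := by
  induction s using Multiset.induction_on with
  | empty => exact ⟨1, 0, by simp, by simp, by simp⟩
  | cons i s ih =>
    obtain ⟨q1, q2, h1, h2, h⟩ := ih
    refine ⟨C (a i) * X * q1 + C (b i) * (1 - X ^ 2) * q2, C (a i) * X * q2 + C (b i) * q1,
      ?_, ?_, ?_⟩
    · rw [Multiset.card_cons, ← natDegree_le_iff_degree_le]
      have h1' : q1.natDegree ≤ s.card := natDegree_le_iff_degree_le.2 h1
      by_cases hq : q2 = 0
      · subst hq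
        simp only [mul_zero, add_zero]
        compute_degree
        omega
      · have h2' : q2.natDegree < s.card := (natDegree_lt_iff_degree_lt hq).2 h2
        compute_degree
        exact max_le (by omega) (by omega)
    · rw [Multiset.card_cons]
      have h1' : q1.natDegree ≤ s.card := natDegree_le_iff_degree_le.2 h1
      refine lt_of_le_of_lt (b := ((s.card : ℕ) : WithBot ℕ)) ?_ (by exact_mod_cast Nat.lt_succ_self _)
      rw [← natDegree_le_iff_degree_le]
      by_cases hq : q2 = 0
      · subst hq
        simp only [mul_zero, zero_add]
        compute_degree
        omega
      · have h2' : q2.natDegree < s.card := (natDegree_lt_iff_degree_lt hq).2 h2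
        compute_degree
        exact max_le (by omega) (by omega)
    · intro φ
      rw [Multiset.map_cons, Multiset.prod_cons, h φ]
      simp only [eval_add, eval_mul, eval_C, eval_X, eval_sub, eval_one, eval_pow]
      have := Real.sin_sq_add_cos_sq φ
      linear_combination (b i * q2.eval (Real.cos φ)) * this

open Polynomial in
lemma trig_rep {m : Type*} (p : MvPolynomial m ℝ) (n : ℕ) (hp : p.totalDegree ≤ n)
    (a b : m → ℝ) :
    ∃ q1 q2 : ℝ[X], q1.degree ≤ (n : ℕ) ∧ q2.degree < (n : ℕ) ∧ ∀ φ : ℝ,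
      MvPolynomial.eval (fun i => Real.cos φ * a i + Real.sin φ * b i) p
        = q1.eval (Real.cos φ) + Real.sin φ * q2.eval (Real.cos φ) := by
  choose q1 q2 h1 h2 h using fun s : m →₀ ℕ => trig_rep_multiset a b s.toMultiset
  refine ⟨∑ s ∈ p.support, C (p.coeff s) * q1 s, ∑ s ∈ p.support, C (p.coeff s) * q2 s, ?_, ?_, ?_⟩
  · refine (degree_sum_le _ _).trans (Finset.sup_le fun s hs => ?_)
    have hs' := (MvPolynomial.le_totalDegree hs).trans hp
    rw [MvPolynomial.mem_support_iff] at hs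
    rw [degree_C_mul hs]
    refine (h1 s).trans ?_
    rw [Finsupp.card_toMultiset]
    exact_mod_cast hs'
  · rw [← mem_degreeLT]
    refine Submodule.sum_mem _ fun s hs => ?_
    have hs' := (MvPolynomial.le_totalDegree hs).trans hp
    rw [mem_degreeLT]
    rw [MvPolynomial.mem_support_iff] at hs
    rw [degree_C_mul hs]
    refine (h2 s).trans_le ?_
    rw [Finsupp.card_toMultiset]
    exact_mod_cast hs'
  · intro φ
    rw [MvPolynomial.eval_eq, eval_finsetSum, eval_finsetSum, Finset.mul_sum,
      ← Finset.sum_add_distrib]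
    refine Finset.sum_congr rfl fun s hs => ?_
    have := h s φ
    rw [Finsupp.toMultiset_map, Finsupp.prod_toMultiset] at this
    simp only [eval_mul, eval_C]
    rw [mul_left_comm, ← mul_add, ← this]
    congr 1
    rw [Finsupp.prod_mapDomain_index]
    · rfl
    · simp
    · intros; rw [pow_add]

open Polynomial in
/-- Markov inequality at the endpoint `1`. -/
lemma markov_endpoint {n : ℕ} {P : ℝ[X]} {B : ℝ} (hB : 0 ≤ B) (hdeg : P.degree ≤ (n : ℕ))
    (hb : ∀ x ∈ Set.Icc (-1 : ℝ) 1, |P.eval x| ≤ B) :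
    |(derivative P).eval 1| ≤ n ^ 2 * B := by
  have key : ∀ Q : ℝ[X], Q.degree ≤ (n : ℕ) → (∀ x ∈ Set.Icc (-1 : ℝ) 1, |Q.eval x| ≤ 1) →
      (derivative Q).eval 1 ≤ (n : ℝ) ^ 2 := by
    intro Q h1 h2
    have := Polynomial.Chebyshev.eval_iterate_derivative_le_of_forall_abs_le_one (k := 1)
      (le_refl (1 : ℝ)) h1 h2
    simp only [Function.iterate_one, Chebyshev.T_derivative_eq_U, eval_mul,
      Chebyshev.U_eval_one] at this
    simp at this
    nlinarith
  have key2 : ∀ Q : ℝ[X], ∀ A : ℝ, 0 < A → Q.degree ≤ (n : ℕ) →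
      (∀ x ∈ Set.Icc (-1 : ℝ) 1, |Q.eval x| ≤ A) → (derivative Q).eval 1 ≤ (n : ℝ) ^ 2 * A := by
    intro Q A hA h1 h2
    have := key (C A⁻¹ * Q) (by rwa [degree_C_mul (by positivity)]) (by
      intro x hx
      rw [eval_mul, eval_C, abs_mul, abs_of_pos (by positivity : 0 < A⁻¹)]
      rw [inv_mul_le_iff₀ hA, mul_one]
      exact h2 x hx)
    rw [derivative_C_mul, eval_mul, eval_C, inv_mul_le_iff₀ hA] at this
    linarith
  have key3 : ∀ A : ℝ, B < A → |(derivative P).eval 1| ≤ (n : ℝ) ^ 2 * A := by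
    intro A hA
    rw [abs_le]
    constructor
    · have := key2 (-P) A (by linarith) (by simpa using hdeg)
        (fun x hx => by rw [eval_neg, abs_neg]; exact (hb x hx).trans hA.le)
      rw [derivative_neg, eval_neg] at this
      linarith
    · exact key2 P A (by linarith) hdeg (fun x hx => (hb x hx).trans hA.le)
  have hc : Filter.Tendsto (fun A : ℝ => (n : ℝ) ^ 2 * A) (nhdsWithin B (Set.Ioi B))
      (nhds ((n : ℝ) ^ 2 * B)) := by
    apply Filter.Tendsto.mono_left _ nhdsWithin_le_nhds
    exact (continuous_const.mul continuous_id).tendsto _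
  exact ge_of_tendsto hc (by filter_upwards [self_mem_nhdsWithin] with A hA using key3 A hA)

open Polynomial in
lemma trig_hasDerivAt (q1 q2 : ℝ[X]) (φ : ℝ) :
    HasDerivAt (fun φ => q1.eval (Real.cos φ) + Real.sin φ * q2.eval (Real.cos φ))
      (-Real.sin φ * (derivative q1).eval (Real.cos φ) + (Real.cos φ * q2.eval (Real.cos φ)
        + Real.sin φ * (-Real.sin φ * (derivative q2).eval (Real.cos φ)))) φ := by
  have h : ∀ q : ℝ[X], HasDerivAt (fun φ => q.eval (Real.cos φ))
      (-Real.sin φ * (derivative q).eval (Real.cos φ)) φ := by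
    intro q
    have := (q.hasDerivAt (Real.cos φ)).comp φ (Real.hasDerivAt_cos φ)
    rw [mul_comm]
    exact this
  exact (h q1).add ((Real.hasDerivAt_sin φ).mul (h q2))

open Polynomial in
lemma trig_hasDerivAt2 (q1 q2 : ℝ[X]) :
    HasDerivAt (fun φ => -Real.sin φ * (derivative q1).eval (Real.cos φ)
      + (Real.cos φ * q2.eval (Real.cos φ)
        + Real.sin φ * (-Real.sin φ * (derivative q2).eval (Real.cos φ))))
      (-(derivative q1).eval 1) 0 := by
  have h : ∀ q : ℝ[X], HasDerivAt (fun φ => q.eval (Real.cos φ))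
      (-Real.sin 0 * (derivative q).eval (Real.cos 0)) 0 := by
    intro q
    have := (q.hasDerivAt (Real.cos 0)).comp 0 (Real.hasDerivAt_cos 0)
    rw [mul_comm]
    exact this
  have hs := Real.hasDerivAt_sin 0
  have hc := Real.hasDerivAt_cos 0
  convert! (hs.neg.mul (h (derivative q1))).add ((hc.mul (h q2)).add
    (hs.mul (hs.neg.mul (h (derivative q2))))) using 1
  simp

open Polynomial in
lemma bern_circle {m : Type*} (p : MvPolynomial m ℝ) (n : ℕ) (hn : 0 < n)
    (hp : p.totalDegree ≤ n) (a b : m → ℝ) (B : ℝ) (hB : 0 ≤ B)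
    (hb : ∀ φ : ℝ, |MvPolynomial.eval (fun i => Real.cos φ * a i + Real.sin φ * b i) p| ≤ B)
    (φ : ℝ) :
    |MvPolynomial.eval (fun i => Real.cos φ * a i + Real.sin φ * b i) p
      - MvPolynomial.eval a p| ≤ 3 * n * B * |φ| := by
  set g : ℝ → ℝ := fun φ => MvPolynomial.eval (fun i => Real.cos φ * a i + Real.sin φ * b i) p
    with hg
  obtain ⟨r1, r2, -, -, hr⟩ := trig_rep p n hp a b
  set G : ℝ → ℝ := fun φ => (-Real.sin φ * (derivative r1).eval (Real.cos φ)
    + (Real.cos φ * r2.eval (Real.cos φ)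
        + Real.sin φ * (-Real.sin φ * (derivative r2).eval (Real.cos φ)))) with hGdef
  have hG : ∀ φ, HasDerivAt g (G φ) φ := by
    intro φ
    have : g = fun φ => r1.eval (Real.cos φ) + Real.sin φ * r2.eval (Real.cos φ) := by
      ext φ; exact hr φ
    rw [this]
    exact trig_hasDerivAt r1 r2 φ
  -- second derivative
  have hG2 : ∀ θ, ∃ c, HasDerivAt G c θ ∧ |c| ≤ n ^ 2 * B := by
    intro θ
    obtain ⟨q1, q2, hq1, -, hq⟩ := trig_rep p n hp
      (fun i => Real.cos θ * a i + Real.sin θ * b i)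
      (fun i => -Real.sin θ * a i + Real.cos θ * b i)
    have hsh : ∀ φ, g (φ + θ) = q1.eval (Real.cos φ) + Real.sin φ * q2.eval (Real.cos φ) := by
      intro φ
      rw [← hq φ, hg]
      simp only
      congr 2
      ext i
      rw [Real.cos_add, Real.sin_add]
      ring
    have hGs : ∀ φ, G (φ + θ) = -Real.sin φ * (derivative q1).eval (Real.cos φ)
      + (Real.cos φ * q2.eval (Real.cos φ)
        + Real.sin φ * (-Real.sin φ * (derivative q2).eval (Real.cos φ))) := by
      intro φ
      have h1 : HasDerivAt (fun φ => g (φ + θ)) (G (φ + θ)) φ := (hG (φ + θ)).comp_add_const φ θ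
      have h2 := trig_hasDerivAt q1 q2 φ
      rw [← funext hsh] at h2
      exact h1.unique h2
    refine ⟨-(derivative q1).eval 1, ?_, ?_⟩
    · have h2 := trig_hasDerivAt2 q1 q2
      rw [← funext hGs] at h2
      have h3 : HasDerivAt (fun φ => G (φ + θ)) (-(derivative q1).eval 1) (θ - θ) := by
        rwa [sub_self]
      have h4 := h3.comp_sub_const θ θ
      simpa using h4
    · rw [abs_neg]
      refine markov_endpoint hB hq1 ?_
      intro x hx
      have hx' : Real.cos (Real.arccos x) = x := Real.cos_arccos hx.1 hx.2
      set φ := Real.arccos x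
      have e1 := hsh φ
      have e2 := hsh (-φ)
      rw [Real.cos_neg, Real.sin_neg] at e2
      rw [hx'] at e1 e2
      have b1 := abs_le.1 (hb (φ + θ))
      have b2 := abs_le.1 (hb (-φ + θ))
      change -B ≤ g (φ + θ) ∧ g (φ + θ) ≤ B at b1
      change -B ≤ g (-φ + θ) ∧ g (-φ + θ) ≤ B at b2
      rw [abs_le]
      constructor <;> linarith [b1.1, b1.2, b2.1, b2.2]
  choose c hc hcb using hG2
  have hn' : (0 : ℝ) < n := by exact_mod_cast hn
  -- bound on the first derivative
  have hGb : ∀ θ, |G θ| ≤ 3 * n * B := by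
    intro θ
    obtain ⟨ξ, hξ, he⟩ := exists_hasDerivAt_eq_slope g G (show θ < θ + 1 / n by
      have : (0 : ℝ) < 1 / n := by positivity
      linarith)
      (fun x _ => (hG x).continuousAt.continuousWithinAt) (fun x _ => hG x)
    have h1 : |G ξ| ≤ 2 * n * B := by
      rw [he, add_sub_cancel_left, div_div_eq_mul_div, div_one, abs_mul, abs_of_pos hn']
      have b1 := abs_le.1 (hb (θ + 1 / n))
      have b2 := abs_le.1 (hb θ)
      have : |g (θ + 1 / n) - g θ| ≤ 2 * B := by
        rw [abs_le]
        constructor <;> simp only [hg] <;> linarith [b1.1, b1.2, b2.1, b2.2]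
      nlinarith
    have h2 : ‖G θ - G ξ‖ ≤ n ^ 2 * B * ‖θ - ξ‖ :=
      Convex.norm_image_sub_le_of_norm_hasDerivWithin_le (s := Set.univ)
        (fun x _ => (hc x).hasDerivWithinAt) (fun x _ => hcb x) convex_univ trivial trivial
    have h3 : ‖θ - ξ‖ ≤ 1 / n := by
      rw [Real.norm_eq_abs, abs_le]
      constructor <;> linarith [hξ.1, hξ.2]
    have h4 : ‖G θ - G ξ‖ ≤ n * B := by
      refine h2.trans ?_
      calc n ^ 2 * B * ‖θ - ξ‖ ≤ n ^ 2 * B * (1 / n) := by gcongr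
        _ = n * B := by field_simp
    rw [Real.norm_eq_abs] at h4
    have := abs_sub_abs_le_abs_sub (G θ) (G ξ)
    linarith
  have h0 : MvPolynomial.eval a p = g 0 := by simp [hg]
  rw [h0]
  have := Convex.norm_image_sub_le_of_norm_hasDerivWithin_le (s := Set.univ) (x := 0) (y := φ)
        (fun x _ => (hG x).hasDerivWithinAt) (fun x _ => hGb x) convex_univ trivial trivial
  simpa using this

/-- Bernstein inequality on the sphere. -/
lemma bern_sphere {d : ℕ} (p : MvPolynomial (Fin (d + 1)) ℝ) (n : ℕ) (hn : 0 < n)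
    (hp : p.totalDegree ≤ n) (B : ℝ) (hB : ∀ x : Ed d, ‖x‖ = 1 → |ev p x| ≤ B)
    (x y : Ed d) (hx : ‖x‖ = 1) (hy : ‖y‖ = 1) :
    |ev p x - ev p y| ≤ 5 * n * B * ‖x - y‖ := by
  have hB0 : 0 ≤ B := (abs_nonneg _).trans (hB x hx)
  have hn' : (1 : ℝ) ≤ n := by exact_mod_cast hn
  have hsq : ‖x - y‖ ^ 2 = 2 - 2 * inner ℝ x y := by
    rw [norm_sub_sq_real, hx, hy]; ring
  by_cases hxy : inner ℝ x y ≤ (0 : ℝ)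
  · have h1 : 1 ≤ ‖x - y‖ := by nlinarith [norm_nonneg (x - y)]
    have b1 := abs_le.1 (hB x hx)
    have b2 := abs_le.1 (hB y hy)
    have : |ev p x - ev p y| ≤ 2 * B := by
      rw [abs_le]; constructor <;> linarith [b1.1, b1.2, b2.1, b2.2]
    refine this.trans ?_
    have h2 : B ≤ n * B := by nlinarith
    have h3 : n * B ≤ n * B * ‖x - y‖ := by
      have : 0 ≤ n * B := by positivity
      nlinarith
    nlinarith
  push Not at hxy
  set u : Ed d := y - (inner ℝ x y : ℝ) • x with hu
  have hxx : inner ℝ x x = (1 : ℝ) := by rw [real_inner_self_eq_norm_sq, hx]; norm_num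
  have hxu : inner ℝ x u = (0 : ℝ) := by
    rw [hu, inner_sub_right, inner_smul_right, hxx]; ring
  have hu2 : ‖u‖ ^ 2 = 1 - (inner ℝ x y) ^ 2 := by
    rw [hu, norm_sub_sq_real, inner_smul_right, norm_smul, hx, hy, real_inner_comm]
    simp only [Real.norm_eq_abs, mul_one, sq_abs]
    ring
  have hle : inner ℝ x y ≤ (1 : ℝ) := by
    nlinarith [sq_nonneg ‖x - y‖]
  have hux : ‖u‖ ≤ ‖x - y‖ := by
    apply le_of_sq_le_sq _ (norm_nonneg _)
    rw [hu2, hsq]; nlinarith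
  by_cases hu0 : ‖u‖ = 0
  · have : inner ℝ x y = (1 : ℝ) := by
      rw [hu0] at hu2; nlinarith
    have hu0' : u = 0 := norm_eq_zero.1 hu0
    rw [hu, this, one_smul, sub_eq_zero] at hu0'
    simp [hu0']
  have hupos : 0 < ‖u‖ := lt_of_le_of_ne (norm_nonneg _) (Ne.symm hu0)
  set v : Ed d := ‖u‖⁻¹ • u with hv
  have hvn : ‖v‖ = 1 := by rw [hv, norm_smul, norm_inv, norm_norm]; field_simp
  have hxv : inner ℝ x v = (0 : ℝ) := by rw [hv, inner_smul_right, hxu, mul_zero]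
  have hcirc : ∀ φ : ℝ, ‖Real.cos φ • x + Real.sin φ • v‖ = 1 := by
    intro φ
    have : ‖Real.cos φ • x + Real.sin φ • v‖ ^ 2 = 1 := by
      rw [norm_add_sq_real, inner_smul_left, inner_smul_right, hxv, norm_smul, norm_smul, hx, hvn]
      simp only [Real.norm_eq_abs, mul_one, sq_abs, mul_zero]
      linarith [Real.sin_sq_add_cos_sq φ]
    nlinarith [norm_nonneg (Real.cos φ • x + Real.sin φ • v)]
  have hu1 : ‖u‖ ≤ 1 := by nlinarith [sq_nonneg (inner ℝ x y : ℝ)]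
  set φ := Real.arcsin ‖u‖ with hφ
  have hsin : Real.sin φ = ‖u‖ := Real.sin_arcsin (by linarith) hu1
  have hcos : Real.cos φ = inner ℝ x y := by
    rw [hφ, Real.cos_arcsin, hu2, sub_sub_cancel, Real.sqrt_sq hxy.le]
  have hyφ : y = Real.cos φ • x + Real.sin φ • v := by
    rw [hsin, hcos, hv, smul_smul, mul_inv_cancel₀ hu0, one_smul, hu]; abel
  have key := bern_circle p n hn hp (fun i => x i) (fun i => v i) B hB0
    (fun φ => by
      have := hB _ (hcirc φ)
      simpa [ev] using this) φ
  have hy' : ev p y = MvPolynomial.eval (fun i => Real.cos φ * x i + Real.sin φ * v i) p := by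
    conv_lhs => rw [hyφ]
    simp [ev]
  rw [abs_sub_comm, hy']
  refine key.trans ?_
  have hφ0 : 0 ≤ φ := Real.arcsin_nonneg.2 (norm_nonneg _)
  have hφ1 : φ ≤ Real.pi / 2 := Real.arcsin_le_pi_div_two _
  have hj := Real.mul_le_sin hφ0 hφ1
  rw [hsin] at hj
  have hpi := Real.pi_lt_d2
  have hpos := Real.pi_pos
  have : φ ≤ 5 / 3 * ‖x - y‖ := by
    have h1 : φ ≤ Real.pi / 2 * ‖u‖ := by
      have : φ = Real.pi / 2 * (2 / Real.pi * φ) := by field_simp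
      rw [this]; gcongr
    have h2 : Real.pi / 2 * ‖u‖ ≤ 5 / 3 * ‖u‖ := by
      exact mul_le_mul_of_nonneg_right (by linarith) (norm_nonneg _)
    linarith
  rw [abs_of_nonneg hφ0]
  calc 3 * n * B * φ ≤ 3 * n * B * (5 / 3 * ‖x - y‖) := by gcongr
    _ = _ := by ring

lemma abs_sin_nat_mul_le (n : ℕ) (φ : ℝ) : |Real.sin (n * φ)| ≤ n * |Real.sin φ| := by
  induction n with
  | zero => simp
  | succ k ih =>
    push_cast
    rw [add_mul, one_mul, Real.sin_add]
    calc |Real.sin (k * φ) * Real.cos φ + Real.cos (k * φ) * Real.sin φ|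
        ≤ |Real.sin (k * φ) * Real.cos φ| + |Real.cos (k * φ) * Real.sin φ| := abs_add_le _ _
      _ ≤ |Real.sin (k * φ)| * 1 + 1 * |Real.sin φ| := by
          rw [abs_mul, abs_mul]
          gcongr
          · exact Real.abs_cos_le_one _
          · exact Real.abs_cos_le_one _
      _ ≤ _ := by linarith

open Polynomial in
lemma kernel_poly (n : ℕ) (hn : 0 < n) : ∃ r : ℝ[X], r.natDegree ≤ n ∧ r.eval 1 = 1 ∧
    ∀ u : ℝ, -1 ≤ u → u ≤ 1 → 0 ≤ r.eval u ∧ r.eval u ≤ 1 ∧ r.eval u * (n ^ 2 * (1 - u)) ≤ 2 := by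
  have hn' : (0 : ℝ) < n := by exact_mod_cast hn
  have hroot : (Chebyshev.T ℝ n - 1).IsRoot 1 := by
    simp [IsRoot, Chebyshev.T_eval_one]
  obtain ⟨r, hr⟩ := dvd_iff_isRoot.2 hroot
  have hr1 : r.eval 1 = (n : ℝ) ^ 2 := by
    have h1 := congrArg (fun q => (derivative q).eval 1) hr
    simp [Chebyshev.T_derivative_eq_U, Chebyshev.U_eval_one] at h1
    rw [← h1]; ring
  have hru : ∀ u : ℝ, (1 - u) * r.eval u = 1 - (Chebyshev.T ℝ n).eval u := by
    intro u
    have h1 := congrArg (fun q => q.eval u) hr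
    simp at h1
    linarith
  refine ⟨C ((n : ℝ) ^ 2)⁻¹ * r, ?_, ?_, ?_⟩
  · refine (natDegree_C_mul_le _ _).trans ?_
    by_cases h0 : r = 0
    · simp [h0]
    have h1 := congrArg natDegree hr
    rw [natDegree_mul (X_sub_C_ne_zero 1) h0, natDegree_X_sub_C] at h1
    have h2 : (Chebyshev.T ℝ (n : ℤ) - 1).natDegree ≤ n := by
      refine (natDegree_sub_le _ _).trans ?_
      rw [Chebyshev.natDegree_T]
      simp
    omega
  · rw [eval_mul, eval_C, hr1]; field_simp
  · intro u h1 h2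
    rw [eval_mul, eval_C]
    rcases h2.eq_or_lt with h3 | h3
    · subst h3
      rw [hr1]
      have : ((n : ℝ) ^ 2)⁻¹ * (n : ℝ) ^ 2 = 1 := by field_simp
      rw [this]; norm_num
    have hT : (Chebyshev.T ℝ n).eval u = Real.cos (n * Real.arccos u) := by
      have := Chebyshev.T_real_cos (Real.arccos u) n
      rw [Real.cos_arccos h1 h2] at this
      simpa using this
    set θ := Real.arccos u
    have hcu : Real.cos θ = u := Real.cos_arccos h1 h2
    have e1 : 1 - Real.cos (n * θ) = 2 * Real.sin (n * (θ / 2)) ^ 2 := by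
      have := Real.cos_sq (n * θ / 2)
      rw [mul_div_cancel₀ _ (two_ne_zero)] at this
      have h4 := Real.sin_sq_add_cos_sq (n * θ / 2)
      rw [← mul_div_assoc]
      linarith
    have e2 : 1 - u = 2 * Real.sin (θ / 2) ^ 2 := by
      have := Real.cos_sq (θ / 2)
      rw [mul_div_cancel₀ _ (two_ne_zero)] at this
      have h4 := Real.sin_sq_add_cos_sq (θ / 2)
      rw [hcu] at this
      linarith
    have e3 : Real.sin (n * (θ / 2)) ^ 2 ≤ n ^ 2 * Real.sin (θ / 2) ^ 2 := by
      have := abs_sin_nat_mul_le n (θ / 2)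
      have h5 := pow_le_pow_left₀ (abs_nonneg _) this 2
      rw [mul_pow, sq_abs, sq_abs] at h5
      exact h5
    have e4 := hru u
    rw [hT, e1] at e4
    have hpos : 0 < 1 - u := by linarith
    have hr0 : 0 ≤ r.eval u := by
      by_contra hneg
      push Not at hneg
      have : (1 - u) * r.eval u < 0 := by nlinarith
      nlinarith [sq_nonneg (Real.sin (n * (θ / 2)))]
    refine ⟨by positivity, ?_, ?_⟩
    · rw [inv_mul_le_iff₀ (by positivity), mul_one]
      have : (1 - u) * r.eval u ≤ (1 - u) * n ^ 2 := by
        rw [e4]; nlinarith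
      exact le_of_mul_le_mul_left this hpos
    · have : ((n : ℝ) ^ 2)⁻¹ * r.eval u * (n ^ 2 * (1 - u)) = (1 - u) * r.eval u := by field_simp
      rw [this, e4]
      nlinarith [Real.sin_sq_le_one (n * (θ / 2))]

lemma kernel_mv {d : ℕ} (n : ℕ) (hn : 0 < n) (x : Ed d) (hx : ‖x‖ = 1) :
    ∃ q : MvPolynomial (Fin (d + 1)) ℝ, q.totalDegree ≤ n ∧ ev q x = 1 ∧
      ∀ y : Ed d, ‖y‖ = 1 → 0 ≤ ev q y ∧ ev q y ≤ 1 ∧ ev q y ≤ 9 / (1 + n * ‖x - y‖) ^ 2 := by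
  obtain ⟨r, hr, hr1, hrb⟩ := kernel_poly n hn
  set l : MvPolynomial (Fin (d + 1)) ℝ := ∑ i, MvPolynomial.C (x i) * MvPolynomial.X i with hl
  have hld : l.totalDegree ≤ 1 := by
    refine MvPolynomial.totalDegree_finsetSum_le fun i _ => ?_
    refine (MvPolynomial.totalDegree_mul _ _).trans ?_
    simp
  have hle : ∀ y : Ed d, ev l y = inner ℝ x y := by
    intro y
    simp [ev, hl, PiLp.inner_apply, mul_comm]
  have hev : ∀ y : Ed d, ev (Polynomial.aeval l r) y = r.eval (inner ℝ x y) := by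
    intro y
    rw [← hle y, ev, Polynomial.aeval_def, Polynomial.hom_eval₂, Polynomial.eval]
    congr 1
    ext c
    simp
  refine ⟨Polynomial.aeval l r, ?_, ?_, ?_⟩
  · rw [Polynomial.aeval_eq_sum_range]
    refine MvPolynomial.totalDegree_finsetSum_le fun i hi => ?_
    refine (MvPolynomial.totalDegree_smul_le _ _).trans ?_
    refine (MvPolynomial.totalDegree_pow _ _).trans ?_
    have : i ≤ n := by
      have := Finset.mem_range.1 hi
      omega
    nlinarith
  · rw [hev, real_inner_self_eq_norm_sq, hx, one_pow, hr1]
  · intro y hy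
    have hsq : ‖x - y‖ ^ 2 = 2 - 2 * inner ℝ x y := by
      rw [norm_sub_sq_real, hx, hy]; ring
    have hab := abs_le.1 (abs_real_inner_le_norm x y)
    rw [hx, hy, mul_one] at hab
    obtain ⟨h0, h1, h2⟩ := hrb _ hab.1 hab.2
    rw [hev]
    refine ⟨h0, h1, ?_⟩
    set ρ := r.eval (inner ℝ x y)
    set w := n * ‖x - y‖ with hw
    have hw0 : 0 ≤ w := by positivity
    have h3 : ρ * w ^ 2 ≤ 4 := by
      rw [hw, mul_pow, hsq]; nlinarith
    rw [le_div_iff₀ (by positivity)]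
    by_cases hw2 : w ≤ 2
    · nlinarith
    · push Not at hw2
      -- ρ ≤ 4/w², (1+w)² ≤ 9/4 w²
      have : (1 + w) ^ 2 ≤ 9 / 4 * w ^ 2 := by nlinarith
      nlinarith

/-- Ahlfors regularity data for a probability measure on the unit sphere. -/
structure Reg (d : ℕ) (σ : Measure (Ed d)) (a A : ℝ) : Prop where
  ha : 0 < a
  hA : 0 < A
  prob : IsProbabilityMeasure σ
  conc : ∀ᵐ x ∂σ, ‖x‖ = 1
  lower : ∀ x : Ed d, ‖x‖ = 1 → ∀ ρ : ℝ, 0 < ρ → ρ ≤ 1 → a * ρ ^ d ≤ σ.real (Metric.closedBall x ρ)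
  upper : ∀ x : Ed d, ‖x‖ = 1 → ∀ ρ : ℝ, 0 < ρ → σ.real (Metric.closedBall x ρ) ≤ A * ρ ^ d

lemma ev_continuous {d : ℕ} (p : MvPolynomial (Fin (d + 1)) ℝ) : Continuous (ev p) := by
  have := MvPolynomial.continuous_eval p
  exact this.comp (by fun_prop)

/-- Continuous functions are integrable. -/
lemma Reg.integrable {d : ℕ} {σ : Measure (Ed d)} {a A : ℝ} (h : Reg d σ a A)
    {f : Ed d → ℝ} (hf : ContinuousOn f (Metric.sphere 0 1)) : Integrable f σ := by
  have := h.prob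
  have hr : σ.restrict (Metric.sphere 0 1) = σ := by
    rw [Measure.restrict_eq_self_of_ae_mem]
    filter_upwards [h.conc] with x hx
    simpa using hx
  rw [← hr]
  exact hf.integrableOn_compact (isCompact_sphere 0 1)

/-- Nikolskii inequality. -/
lemma nikolskii {d : ℕ} {σ : Measure (Ed d)} {a A : ℝ} (h : Reg d σ a A)
    (p : MvPolynomial (Fin (d + 1)) ℝ) (n : ℕ) (hn : 0 < n) (hp : p.totalDegree ≤ n)
    (x : Ed d) (hx : ‖x‖ = 1) :
    |ev p x| ≤ 2 * 10 ^ d / a * n ^ d * ∫ y, |ev p y| ∂σ := by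
  have hprob := h.prob
  have hn' : (1 : ℝ) ≤ n := by exact_mod_cast hn
  obtain ⟨z, hz, hmax⟩ := (isCompact_sphere (0 : Ed d) 1).exists_isMaxOn ⟨x, by simpa using hx⟩
    (ev_continuous p).abs.continuousOn
  have hz1 : ‖z‖ = 1 := by simpa using hz
  have hmax' : ∀ y : Ed d, ‖y‖ = 1 → |ev p y| ≤ |ev p z| := fun y hy => hmax (by simpa using hy)
  refine (hmax' x hx).trans ?_
  set B := |ev p z| with hB
  set ρ : ℝ := 1 / (10 * n) with hρ
  have hρ0 : 0 < ρ := by positivity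
  have hρ1 : ρ ≤ 1 := by
    rw [hρ, div_le_one (by positivity)]; linarith
  have hintg : Integrable (fun y => |ev p y|) σ := h.integrable (ev_continuous p).abs.continuousOn
  have h1 : B / 2 * σ.real (Metric.closedBall z ρ) ≤ ∫ y, |ev p y| ∂σ := by
    calc B / 2 * σ.real (Metric.closedBall z ρ) = ∫ y in Metric.closedBall z ρ, B / 2 ∂σ := by
          simp [mul_comm]
      _ ≤ ∫ y in Metric.closedBall z ρ, |ev p y| ∂σ := by
          refine integral_mono_ae (by simp) hintg.integrableOn ?_
          have := ae_restrict_of_ae (s := Metric.closedBall z ρ) h.conc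
          filter_upwards [this, ae_restrict_mem Metric.isClosed_closedBall.measurableSet] with y hy hyb
          have hb := bern_sphere p n hn hp B hmax' z y hz1 hy
          have hzy : ‖z - y‖ ≤ ρ := by
            rw [Metric.mem_closedBall, dist_comm, dist_eq_norm] at hyb
            exact hyb
          have : 5 * n * B * ‖z - y‖ ≤ B / 2 := by
            calc 5 * n * B * ‖z - y‖ ≤ 5 * n * B * ρ := by gcongr
              _ = B / 2 := by rw [hρ]; field_simp; ring
          have h3 := abs_sub_abs_le_abs_sub (ev p z) (ev p y)
          linarith
      _ ≤ ∫ y, |ev p y| ∂σ := setIntegral_le_integral hintg (by filter_upwards with y; positivity)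
  have h2 := h.lower z hz1 ρ hρ0 hρ1
  have h3 : B / 2 * (a * ρ ^ d) ≤ ∫ y, |ev p y| ∂σ :=
    (mul_le_mul_of_nonneg_left h2 (by positivity)).trans h1
  have ha := h.ha
  calc B = 2 * 10 ^ d / a * n ^ d * (B / 2 * (a * ρ ^ d)) := by
        rw [hρ, div_pow, mul_pow]; field_simp; simp
    _ ≤ _ := by gcongr

/-- Slowly varying majorant. -/
noncomputable def Mj (d : ℕ) (σ : Measure (Ed d)) (n : ℕ) (f : Ed d → ℝ) (x : Ed d) : ℝ :=
  (n : ℝ) ^ d * ∫ y, f y / (1 + n * ‖x - y‖) ^ (2 * (d + 1)) ∂σ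

lemma Mj_integrable {d : ℕ} {σ : Measure (Ed d)} {a A : ℝ} (h : Reg d σ a A)
    (n : ℕ) {f : Ed d → ℝ} (hf : Continuous f) (x : Ed d) :
    Integrable (fun y => f y / (1 + n * ‖x - y‖) ^ (2 * (d + 1))) σ := by
  refine h.integrable (Continuous.continuousOn ?_)
  refine hf.div (by fun_prop) (fun y => ?_)
  positivity

lemma Mj_nonneg {d : ℕ} {σ : Measure (Ed d)}
    (n : ℕ) {f : Ed d → ℝ} (hf0 : ∀ x, 0 ≤ f x) (x : Ed d) : 0 ≤ Mj d σ n f x := by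
  refine mul_nonneg (by positivity) (integral_nonneg fun y => ?_)
  have := hf0 y
  positivity

lemma Mj_le {d : ℕ} {σ : Measure (Ed d)} {a A : ℝ} (h : Reg d σ a A)
    (n : ℕ) {f : Ed d → ℝ} (hf : Continuous f) (hf0 : ∀ x, 0 ≤ f x) (x y : Ed d) :
    Mj d σ n f y ≤ (1 + n * ‖x - y‖) ^ (2 * (d + 1)) * Mj d σ n f x := by
  unfold Mj
  rw [mul_left_comm]
  have hn0 : (0 : ℝ) ≤ (n : ℝ) ^ d := by positivity
  refine mul_le_mul_of_nonneg_left ?_ hn0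
  rw [← integral_const_mul]
  refine integral_mono (Mj_integrable h n hf y) ((Mj_integrable h n hf x).const_mul _) fun z => ?_
  have h1 : 1 + n * ‖x - z‖ ≤ (1 + n * ‖x - y‖) * (1 + n * ‖y - z‖) := by
    have h2 : ‖x - z‖ ≤ ‖x - y‖ + ‖y - z‖ := norm_sub_le_norm_sub_add_norm_sub x y z
    have h3 : n * ‖x - z‖ ≤ n * (‖x - y‖ + ‖y - z‖) := by gcongr
    have h4 : 0 ≤ (n * ‖x - y‖) * (n * ‖y - z‖) := by positivity
    nlinarith
  have h5 := pow_le_pow_left₀ (by positivity) h1 (2 * (d + 1))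
  rw [mul_pow] at h5
  have := hf0 z
  simp only
  rw [mul_div_assoc', div_le_div_iff₀ (by positivity) (by positivity)]
  calc f z * (1 + n * ‖x - z‖) ^ (2 * (d + 1)) ≤ f z * _ := mul_le_mul_of_nonneg_left h5 this
    _ = _ := by ring

lemma one_add_pow_le (k : ℕ) (τ : ℝ) (h0 : 0 ≤ τ) (h1 : τ ≤ 1) :
    (1 + τ) ^ k ≤ 1 + 2 ^ k * τ := by
  have : (1 + τ) ^ k ≤ 1 + (2 ^ k - 1) * τ := by
    induction k with
    | zero => simp
    | succ k ih =>
      have h2 : (1 : ℝ) ≤ 2 ^ k := one_le_pow₀ (by norm_num)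
      rw [pow_succ, pow_succ]
      have h3 : (1 + τ) ^ k * (1 + τ) ≤ (1 + (2 ^ k - 1) * τ) * (1 + τ) := by gcongr
      refine h3.trans ?_
      nlinarith [mul_nonneg (sub_nonneg.2 h2) (mul_nonneg h0 (sub_nonneg.2 h1))]
  linarith

lemma Mj_le' {d : ℕ} {σ : Measure (Ed d)} {a A : ℝ} (h : Reg d σ a A)
    (n : ℕ) {f : Ed d → ℝ} (hf : Continuous f) (hf0 : ∀ x, 0 ≤ f x) (x y : Ed d)
    (hxy : n * ‖x - y‖ ≤ 1) :
    Mj d σ n f y ≤ 4 ^ (d + 1) * Mj d σ n f x := by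
  refine (Mj_le h n hf hf0 x y).trans ?_
  refine mul_le_mul_of_nonneg_right ?_ (Mj_nonneg n hf0 x)
  calc (1 + n * ‖x - y‖) ^ (2 * (d + 1)) ≤ 2 ^ (2 * (d + 1)) := by
        gcongr; linarith
    _ = 4 ^ (d + 1) := by rw [pow_mul]; norm_num

lemma Mj_sub {d : ℕ} {σ : Measure (Ed d)} {a A : ℝ} (h : Reg d σ a A)
    (n : ℕ) {f : Ed d → ℝ} (hf : Continuous f) (hf0 : ∀ x, 0 ≤ f x) (x y : Ed d)
    (hxy : n * ‖x - y‖ ≤ 1) :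
    |Mj d σ n f x - Mj d σ n f y| ≤ 16 ^ (d + 1) * (n * ‖x - y‖) * Mj d σ n f x := by
  have h1 := Mj_le h n hf hf0 x y
  have h2 := Mj_le h n hf hf0 y x
  have h3 := one_add_pow_le (2 * (d + 1)) (n * ‖x - y‖) (by positivity) hxy
  have h4 := Mj_le' h n hf hf0 x y hxy
  have e : (2 : ℝ) ^ (2 * (d + 1)) = 4 ^ (d + 1) := by rw [pow_mul]; norm_num
  rw [e] at h3
  have e2 : (16 : ℝ) ^ (d + 1) = 4 ^ (d + 1) * 4 ^ (d + 1) := by rw [← mul_pow]; norm_num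
  rw [norm_sub_rev y x] at h2
  have hx0 := Mj_nonneg (σ := σ) n hf0 x
  have hy0 := Mj_nonneg (σ := σ) n hf0 y
  set Mx := Mj d σ n f x
  set My := Mj d σ n f y
  set τ := n * ‖x - y‖
  have hτ : 0 ≤ τ := by positivity
  set D := (1 + τ) ^ (2 * (d + 1))
  have hK : (1 : ℝ) ≤ 4 ^ (d + 1) := one_le_pow₀ (by norm_num)
  set K : ℝ := 4 ^ (d + 1)
  rw [e2, abs_le]
  have hKK : K ≤ K * K := by nlinarith
  constructor
  · have : My ≤ (1 + K * τ) * Mx := h1.trans (by gcongr)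
    have h5 : K * (τ * Mx) ≤ K * K * (τ * Mx) := by gcongr
    nlinarith
  · have : Mx ≤ (1 + K * τ) * My := h2.trans (by gcongr)
    have h5 : K * τ * My ≤ K * τ * (K * Mx) := by gcongr
    nlinarith

lemma Mj_continuous {d : ℕ} {σ : Measure (Ed d)} {a A : ℝ} (h : Reg d σ a A)
    (n : ℕ) {f : Ed d → ℝ} (hf : Continuous f) : Continuous (Mj d σ n f) := by
  unfold Mj
  refine continuous_const.mul ?_
  refine continuous_of_dominated (bound := fun y => |f y|) ?_ ?_ (h.integrable hf.abs.continuousOn) ?_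
  · intro x
    exact (Mj_integrable h n hf x).aestronglyMeasurable
  · intro x
    filter_upwards with y
    rw [norm_div, Real.norm_eq_abs, Real.norm_eq_abs]
    apply div_le_self (abs_nonneg _)
    rw [abs_of_nonneg (by positivity)]
    apply one_le_pow₀
    have : 0 ≤ n * ‖x - y‖ := by positivity
    linarith
  · filter_upwards with y
    refine continuous_const.div (by fun_prop) (fun x => ?_)
    positivity

lemma kernel_integral {d : ℕ} {σ : Measure (Ed d)} {a A : ℝ} (h : Reg d σ a A)
    (n : ℕ) (hn : 0 < n) (y : Ed d) (hy : ‖y‖ = 1) :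
    (n : ℝ) ^ d * ∫ x, 1 / (1 + n * ‖x - y‖) ^ (2 * (d + 1)) ∂σ ≤ 2 * 2 ^ d * A := by
  have hprob := h.prob
  have hn' : (0 : ℝ) < n := by exact_mod_cast hn
  have hA := h.hA
  set J := 2 * n + 1
  have hpt : ∀ᵐ x ∂σ, 1 / (1 + n * ‖x - y‖) ^ (2 * (d + 1)) ≤
      ∑ j ∈ Finset.range J, (Metric.closedBall y (2 ^ (j + 1) / n)).indicator
        (fun _ => ((1 / 2 : ℝ) ^ j) ^ (d + 1)) x := by
    filter_upwards [h.conc] with x hx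
    set w := n * ‖x - y‖ with hw
    have hw0 : 0 ≤ w := by positivity
    have hw2 : w ≤ 2 * n := by
      have : ‖x - y‖ ≤ 2 := by
        have := norm_sub_le x y
        rw [hx, hy] at this; linarith
      rw [hw]; nlinarith
    obtain ⟨j, hj1, hj2⟩ := exists_nat_pow_near (show (1 : ℝ) ≤ 1 + w by linarith)
      (show (1 : ℝ) < 2 by norm_num)
    have hjJ : j ∈ Finset.range J := by
      rw [Finset.mem_range]
      have h1 : (2 : ℝ) ^ j ≤ 1 + 2 * n := by linarith
      have h2 : (2 : ℕ) ^ j ≤ J := by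
        have : ((2 ^ j : ℕ) : ℝ) ≤ (J : ℕ) := by simp only [J]; push_cast; linarith
        exact_mod_cast this
      exact lt_of_lt_of_le Nat.lt_two_pow_self h2
    have hmem : x ∈ Metric.closedBall y (2 ^ (j + 1) / n) := by
      rw [Metric.mem_closedBall, dist_eq_norm, le_div_iff₀ hn', mul_comm]
      linarith
    refine le_trans ?_ (Finset.single_le_sum (f := fun j =>
      (Metric.closedBall y (2 ^ (j + 1) / n)).indicator
        (fun _ => ((1 / 2 : ℝ) ^ j) ^ (d + 1)) x) (fun i _ => ?_) hjJ)
    · simp only [Set.indicator_of_mem hmem]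
      rw [div_pow, one_pow, div_pow, one_pow]
      apply one_div_le_one_div_of_le (by positivity)
      calc ((2 : ℝ) ^ j) ^ (d + 1) ≤ (1 + w) ^ (d + 1) := by gcongr
        _ ≤ _ := pow_le_pow_right₀ (by linarith) (by omega)
    · exact Set.indicator_nonneg (fun _ _ => by positivity) _
  have hintg : ∀ j ∈ Finset.range J, Integrable ((Metric.closedBall y (2 ^ (j + 1) / n)).indicator
        (fun _ => ((1 / 2 : ℝ) ^ j) ^ (d + 1))) σ := fun j _ =>
    (integrable_const _).indicator Metric.isClosed_closedBall.measurableSet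
  have hintg1 : Integrable (fun x => 1 / (1 + n * ‖x - y‖) ^ (2 * (d + 1))) σ := by
    refine h.integrable (Continuous.continuousOn ?_)
    refine continuous_const.div (by fun_prop) (fun y => ?_)
    positivity
  have h1 := integral_mono_ae hintg1 (integrable_finsetSum _ hintg) hpt
  rw [integral_finsetSum _ hintg] at h1
  have h2 : ∀ j ∈ Finset.range J, ∫ x, (Metric.closedBall y (2 ^ (j + 1) / n)).indicator
        (fun _ => ((1 / 2 : ℝ) ^ j) ^ (d + 1)) x ∂σ ≤ (2 ^ d * A / n ^ d) * (1 / 2) ^ j := by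
    intro j _
    rw [integral_indicator_const _ Metric.isClosed_closedBall.measurableSet, smul_eq_mul]
    have := h.upper y hy (2 ^ (j + 1) / n) (by positivity)
    calc _ ≤ A * (2 ^ (j + 1) / n) ^ d * ((1 / 2 : ℝ) ^ j) ^ (d + 1) := by gcongr
      _ = _ := by
        rw [div_pow, pow_succ (2 : ℝ) j, mul_pow, pow_succ ((1 / 2 : ℝ) ^ j) d]
        have : ((2 : ℝ) ^ j) ^ d * ((1 / 2 : ℝ) ^ j) ^ d = 1 := by
          rw [← mul_pow, ← mul_pow]; norm_num
        linear_combination (2 ^ d * A / n ^ d * (1 / 2) ^ j) * this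
  have h3 := h1.trans (Finset.sum_le_sum h2)
  rw [← Finset.mul_sum] at h3
  have h4 : ∑ j ∈ Finset.range J, (1 / 2 : ℝ) ^ j ≤ 2 := by
    exact sum_geometric_two_le J
  calc (n : ℝ) ^ d * ∫ x, 1 / (1 + n * ‖x - y‖) ^ (2 * (d + 1)) ∂σ
      ≤ n ^ d * ((2 ^ d * A / n ^ d) * 2) := by
        gcongr
        exact h3.trans (by gcongr)
    _ = _ := by field_simp

lemma Mj_integral {d : ℕ} {σ : Measure (Ed d)} {a A : ℝ} (h : Reg d σ a A)
    (n : ℕ) (hn : 0 < n) {f : Ed d → ℝ} (hf : Continuous f) (hf0 : ∀ x, 0 ≤ f x) :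
    ∫ x, Mj d σ n f x ∂σ ≤ 2 * 2 ^ d * A * ∫ y, f y ∂σ := by
  have hprob := h.prob
  have hfi : Integrable f σ := h.integrable hf.continuousOn
  have hswap : ∫ x, ∫ y, f y / (1 + n * ‖x - y‖) ^ (2 * (d + 1)) ∂σ ∂σ
      = ∫ y, ∫ x, f y / (1 + n * ‖x - y‖) ^ (2 * (d + 1)) ∂σ ∂σ := by
    apply integral_integral_swap
    have h1 : Integrable (fun z : Ed d × Ed d => f z.2) (σ.prod σ) := hfi.comp_snd σ
    refine h1.mono ?_ ?_
    · apply Continuous.aestronglyMeasurable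
      refine Continuous.div (by fun_prop) (by fun_prop) (fun z => ?_)
      positivity
    · filter_upwards with z
      simp only [Function.uncurry]
      rw [norm_div]
      apply div_le_self (norm_nonneg _)
      rw [Real.norm_eq_abs, abs_of_nonneg (by positivity)]
      apply one_le_pow₀
      have : 0 ≤ n * ‖z.1 - z.2‖ := by positivity
      linarith
  unfold Mj
  rw [integral_const_mul, hswap, ← integral_const_mul, ← integral_const_mul]
  refine integral_mono_of_nonneg ?_ (hfi.const_mul _) ?_
  · filter_upwards with y
    refine mul_nonneg (by positivity) (integral_nonneg fun x => ?_)
    have := hf0 y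
    positivity
  · filter_upwards [h.conc] with y hy
    have h2 := kernel_integral h n hn y hy
    have h3 : ∫ x, f y / (1 + n * ‖x - y‖) ^ (2 * (d + 1)) ∂σ
      = f y * ∫ x, 1 / (1 + n * ‖x - y‖) ^ (2 * (d + 1)) ∂σ := by
      rw [← integral_const_mul]
      congr 1
      ext x
      ring
    rw [h3, mul_left_comm, mul_comm (2 * 2 ^ d * A)]
    exact mul_le_mul_of_nonneg_left h2 (hf0 y)

/-- Constant of the local estimates. -/
noncomputable def cLoc (d : ℕ) (a : ℝ) : ℝ := 2 * 10 ^ d / a * (d + 2) ^ d * 9 ^ (d + 1)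

lemma local_bound {d : ℕ} {σ : Measure (Ed d)} {a A : ℝ} (h : Reg d σ a A)
    (n : ℕ) (hn : 0 < n) {f : Ed d → ℝ} (hf : Continuous f)
    (p : MvPolynomial (Fin (d + 1)) ℝ) (hp : p.totalDegree ≤ n)
    (hpf : ∀ x, |ev p x| ≤ f x) (x : Ed d) (hx : ‖x‖ = 1) :
    ∃ Q : MvPolynomial (Fin (d + 1)) ℝ, Q.totalDegree ≤ n * (d + 1) ∧ ev Q x = 1 ∧
      (∀ y : Ed d, ‖y‖ = 1 → |ev Q y| ≤ 1) ∧
      ∀ y : Ed d, ‖y‖ = 1 → |ev (p * Q) y| ≤ cLoc d a * Mj d σ n f x := by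
  obtain ⟨q, hq, hqx, hqb⟩ := kernel_mv n hn x hx
  have ha := h.ha
  refine ⟨q ^ (d + 1), ?_, ?_, ?_, ?_⟩
  · refine (MvPolynomial.totalDegree_pow _ _).trans ?_
    rw [mul_comm]; gcongr
  · simp only [ev, map_pow]
    rw [show MvPolynomial.eval (fun i => x i) q = 1 from hqx, one_pow]
  · intro y hy
    obtain ⟨h0, h1, -⟩ := hqb y hy
    simp only [ev, map_pow]
    rw [abs_of_nonneg (pow_nonneg h0 _)]
    exact pow_le_one₀ h0 h1
  · intro y hy
    have hdeg : (p * q ^ (d + 1)).totalDegree ≤ n * (d + 2) := by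
      refine (MvPolynomial.totalDegree_mul _ _).trans ?_
      have := (MvPolynomial.totalDegree_pow q (d + 1))
      nlinarith
    have hnik := nikolskii h (p * q ^ (d + 1)) (n * (d + 2)) (by positivity) hdeg y hy
    refine hnik.trans ?_
    have hintg : ∫ z, |ev (p * q ^ (d + 1)) z| ∂σ ≤
        9 ^ (d + 1) * ∫ z, f z / (1 + n * ‖x - z‖) ^ (2 * (d + 1)) ∂σ := by
      rw [← integral_const_mul]
      refine integral_mono_ae (h.integrable (ev_continuous _).abs.continuousOn)
        ((Mj_integrable h n hf x).const_mul _) ?_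
      filter_upwards [h.conc] with z hz
      obtain ⟨h0, h1, h2⟩ := hqb z hz
      have h3 : (ev q z) ^ (d + 1) ≤ 9 ^ (d + 1) / (1 + n * ‖x - z‖) ^ (2 * (d + 1)) := by
        rw [pow_mul, ← div_pow]
        exact pow_le_pow_left₀ h0 h2 _
      have h4 : |ev (p * q ^ (d + 1)) z| = |ev p z| * (ev q z) ^ (d + 1) := by
        simp only [ev, map_mul, map_pow]
        rw [abs_mul, abs_of_nonneg (pow_nonneg h0 _)]
      rw [h4]
      calc _ ≤ f z * (9 ^ (d + 1) / (1 + n * ‖x - z‖) ^ (2 * (d + 1))) :=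
            mul_le_mul (hpf z) h3 (pow_nonneg h0 _) ((abs_nonneg _).trans (hpf z))
        _ = _ := by ring
    calc _ ≤ 2 * 10 ^ d / a * ((n * (d + 2) : ℕ) : ℝ) ^ d *
        (9 ^ (d + 1) * ∫ z, f z / (1 + n * ‖x - z‖) ^ (2 * (d + 1)) ∂σ) := by gcongr
      _ = _ := by
        unfold cLoc Mj
        push_cast
        rw [mul_pow]
        ring

lemma local_val {d : ℕ} {σ : Measure (Ed d)} {a A : ℝ} (h : Reg d σ a A)
    (n : ℕ) (hn : 0 < n) {f : Ed d → ℝ} (hf : Continuous f)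
    (p : MvPolynomial (Fin (d + 1)) ℝ) (hp : p.totalDegree ≤ n)
    (hpf : ∀ x, |ev p x| ≤ f x) (x : Ed d) (hx : ‖x‖ = 1) :
    |ev p x| ≤ cLoc d a * Mj d σ n f x := by
  obtain ⟨Q, -, h1, -, h3⟩ := local_bound h n hn hf p hp hpf x hx
  have := h3 x hx
  have e : ev (p * Q) x = ev p x * ev Q x := by simp [ev]
  rwa [e, h1, mul_one] at this

lemma local_lip {d : ℕ} {σ : Measure (Ed d)} {a A : ℝ} (h : Reg d σ a A)
    (n : ℕ) (hn : 0 < n) {f : Ed d → ℝ} (hf : Continuous f)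
    (p : MvPolynomial (Fin (d + 1)) ℝ) (hp : p.totalDegree ≤ n)
    (hpf : ∀ x, |ev p x| ≤ f x) (x y : Ed d) (hx : ‖x‖ = 1) (hy : ‖y‖ = 1)
    (hxy : n * ‖x - y‖ ≤ 1) :
    |ev p x - ev p y| ≤ 10 * (d + 2) * 4 ^ (d + 1) * cLoc d a * n * ‖x - y‖ * Mj d σ n f x := by
  obtain ⟨Q, hQd, h1, h2, h3⟩ := local_bound h n hn hf p hp hpf x hx
  have hf0 : ∀ x, 0 ≤ f x := fun x => (abs_nonneg _).trans (hpf x)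
  have hval := local_val h n hn hf p hp hpf y hy
  have hM := Mj_le' h n hf hf0 x y hxy
  have ha := h.ha
  have hc : 0 ≤ cLoc d a := by unfold cLoc; positivity
  have hdeg : (p * Q).totalDegree ≤ n * (d + 2) := by
    refine (MvPolynomial.totalDegree_mul _ _).trans ?_
    nlinarith
  have b1 := bern_sphere (p * Q) (n * (d + 2)) (by positivity) hdeg _ h3 x y hx hy
  have b2 := bern_sphere Q (n * (d + 1)) (by positivity) hQd _ h2 x y hx hy
  have e : ∀ z, ev (p * Q) z = ev p z * ev Q z := fun z => by simp [ev]
  rw [e, e, h1, mul_one] at b1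
  rw [h1] at b2
  have hM0 := Mj_nonneg (σ := σ) n hf0 x
  have hsplit : ev p x - ev p y = (ev p x - ev p y * ev Q y) - ev p y * (1 - ev Q y) := by ring
  set Mx := Mj d σ n f x
  set r := ‖x - y‖
  have hr : 0 ≤ r := norm_nonneg _
  have hK : (1 : ℝ) ≤ 4 ^ (d + 1) := one_le_pow₀ (by norm_num)
  have b3 : |ev p y * (1 - ev Q y)| ≤
      (cLoc d a * (4 ^ (d + 1) * Mx)) * (5 * ((n * (d + 1) : ℕ) : ℝ) * 1 * r) := by
    rw [abs_mul]
    exact mul_le_mul (hval.trans (by gcongr)) b2 (abs_nonneg _) (by positivity)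
  rw [hsplit]
  refine (abs_sub _ _).trans ?_
  push_cast at b1 b3
  have b4 : 5 * (n * (d + 2)) * (cLoc d a * Mx) * r ≤
      4 ^ (d + 1) * (5 * (n * (d + 2)) * (cLoc d a * Mx) * r) :=
    le_mul_of_one_le_left (by positivity) hK
  have b5 : (cLoc d a * (4 ^ (d + 1) * Mx)) * (5 * (n * (d + 1)) * 1 * r) ≤
      (cLoc d a * (4 ^ (d + 1) * Mx)) * (5 * (n * (d + 2)) * 1 * r) := by
    gcongr
    norm_num
  calc _ ≤ _ := add_le_add (b1.trans b4) (b3.trans b5)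
    _ = _ := by ring

lemma totalDegree_pderiv_le' {m : Type*} (i : m) (p : MvPolynomial m ℝ) :
    (MvPolynomial.pderiv i p).totalDegree ≤ p.totalDegree := by
  conv_lhs => rw [p.as_sum]
  rw [map_sum]
  refine MvPolynomial.totalDegree_finsetSum_le fun s hs => ?_
  rw [MvPolynomial.pderiv_monomial]
  refine (MvPolynomial.totalDegree_monomial_le _ _).trans ?_
  refine le_trans ?_ (MvPolynomial.le_totalDegree hs)
  have h1 : s - Finsupp.single i 1 ≤ s := tsub_le_self
  exact Finsupp.degree_mono h1

/-- Components of the tangential gradient. -/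
noncomputable def gp {d : ℕ} (P : MvPolynomial (Fin (d + 1)) ℝ) (i : Fin (d + 1)) :
    MvPolynomial (Fin (d + 1)) ℝ :=
  MvPolynomial.pderiv i P -
    MvPolynomial.X i * ∑ j, MvPolynomial.X j * MvPolynomial.pderiv j P

lemma gp_totalDegree {d : ℕ} (P : MvPolynomial (Fin (d + 1)) ℝ) (i : Fin (d + 1)) :
    (gp P i).totalDegree ≤ P.totalDegree + 2 := by
  unfold gp
  refine (MvPolynomial.totalDegree_sub _ _).trans (max_le ?_ ?_)
  · have := totalDegree_pderiv_le' i P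
    omega
  · refine (MvPolynomial.totalDegree_mul _ _).trans ?_
    rw [MvPolynomial.totalDegree_X]
    have : (∑ j, MvPolynomial.X j * MvPolynomial.pderiv j P).totalDegree ≤ P.totalDegree + 1 := by
      refine MvPolynomial.totalDegree_finsetSum_le fun j _ => ?_
      refine (MvPolynomial.totalDegree_mul _ _).trans ?_
      rw [MvPolynomial.totalDegree_X]
      have := totalDegree_pderiv_le' j P
      omega
    omega

/-- Tangential gradient. -/
noncomputable def gr {d : ℕ} (P : MvPolynomial (Fin (d + 1)) ℝ) (x : Ed d) : Ed d :=
  WithLp.toLp 2 (fun i => ev (gp P i) x)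

lemma gr_continuous {d : ℕ} (P : MvPolynomial (Fin (d + 1)) ℝ) : Continuous (gr P) := by
  unfold gr
  refine (PiLp.continuous_toLp 2 _).comp (continuous_pi fun i => ev_continuous _)

lemma norm_le_of_coord {d : ℕ} (v : Ed d) (B : ℝ) (h : ∀ i, |v i| ≤ B) :
    ‖v‖ ≤ (d + 1) * B := by
  have h0 : 0 ≤ B := (abs_nonneg _).trans (h 0)
  rw [EuclideanSpace.norm_eq]
  refine Real.sqrt_le_iff.2 ⟨by positivity, ?_⟩
  calc ∑ i, ‖v i‖ ^ 2 ≤ ∑ _i : Fin (d + 1), B ^ 2 := by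
        refine Finset.sum_le_sum fun i _ => ?_
        have := h i
        rw [Real.norm_eq_abs]
        gcongr
    _ = (d + 1) * B ^ 2 := by simp
    _ ≤ _ := by
      have : (0 : ℝ) ≤ d := by positivity
      nlinarith [mul_nonneg this (sq_nonneg B), mul_nonneg (mul_nonneg this this) (sq_nonneg B)]

/-- A slowly varying majorant of a gradient field. -/
structure GoodM (d : ℕ) (σ : Measure (Ed d)) (n : ℕ) (C : ℝ) (g : Ed d → Ed d) (M : Ed d → ℝ) :
    Prop where
  cont : Continuous M
  nonneg : ∀ x, 0 ≤ M x
  zero : ∀ x y, M x = 0 → M y = 0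
  near : ∀ x y, n * ‖x - y‖ ≤ 1 → M y ≤ C * M x
  lip : ∀ x y, n * ‖x - y‖ ≤ 1 → |M x - M y| ≤ C * (n * ‖x - y‖) * M x
  int : ∫ x, M x ∂σ ≤ C * ∫ x, ‖g x‖ ∂σ
  gle : ∀ x, ‖x‖ = 1 → ‖g x‖ ≤ C * M x
  glip : ∀ x y, ‖x‖ = 1 → ‖y‖ = 1 → n * ‖x - y‖ ≤ 1 → ‖g x - g y‖ ≤ C * (n * ‖x - y‖) * M x

lemma exists_goodM {d : ℕ} {σ : Measure (Ed d)} {a A : ℝ} (h : Reg d σ a A) :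
    ∃ C : ℝ, 1 ≤ C ∧ ∀ n : ℕ, ∀ P : MvPolynomial (Fin (d + 1)) ℝ, P.totalDegree + 2 ≤ n →
      ∃ M, GoodM d σ n C (gr P) M := by
  have ha := h.ha
  have hA := h.hA
  have hc : 0 ≤ cLoc d a := by unfold cLoc; positivity
  set C1 : ℝ := (d + 1) * (10 * (d + 2) * 4 ^ (d + 1) * cLoc d a) with hC1
  have hC1' : 0 ≤ C1 := by positivity
  refine ⟨1 + 4 ^ (d + 1) + 16 ^ (d + 1) + 2 * 2 ^ d * A + (d + 1) * cLoc d a + C1, ?_, ?_⟩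
  · have : 0 ≤ 4 ^ (d + 1) + 16 ^ (d + 1) + 2 * 2 ^ d * A + (d + 1) * cLoc d a + C1 := by positivity
    linarith
  intro n P hP
  have hn : 0 < n := by omega
  have hf : Continuous (fun x => ‖gr P x‖) := (gr_continuous P).norm
  have hf0 : ∀ x, 0 ≤ ‖gr P x‖ := fun x => norm_nonneg _
  have hM0 := Mj_nonneg (σ := σ) n hf0
  have hcoord : ∀ i x, |ev (gp P i) x| ≤ ‖gr P x‖ := fun i x => by
    have := PiLp.norm_apply_le (gr P x) i
    simpa [gr] using this
  have hdeg : ∀ i, (gp P i).totalDegree ≤ n := fun i => (gp_totalDegree P i).trans hP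
  refine ⟨Mj d σ n (fun x => ‖gr P x‖), Mj_continuous h n hf, hM0, ?_, ?_, ?_, ?_, ?_, ?_⟩
  · intro x y h0
    have := Mj_le h n hf hf0 x y
    rw [h0, mul_zero] at this
    exact le_antisymm this (hM0 y)
  · intro x y hxy
    refine (Mj_le' h n hf hf0 x y hxy).trans ?_
    refine mul_le_mul_of_nonneg_right ?_ (hM0 x)
    have : 0 ≤ 1 + 16 ^ (d + 1) + 2 * 2 ^ d * A + (d + 1) * cLoc d a + C1 := by positivity
    linarith
  · intro x y hxy
    refine (Mj_sub h n hf hf0 x y hxy).trans ?_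
    refine mul_le_mul_of_nonneg_right (mul_le_mul_of_nonneg_right ?_ (by positivity)) (hM0 x)
    have : 0 ≤ 1 + 4 ^ (d + 1) + 2 * 2 ^ d * A + (d + 1) * cLoc d a + C1 := by positivity
    linarith
  · refine (Mj_integral h n hn hf hf0).trans ?_
    refine mul_le_mul_of_nonneg_right ?_ (integral_nonneg hf0)
    have : 0 ≤ 1 + 4 ^ (d + 1) + 16 ^ (d + 1) + (d + 1) * cLoc d a + C1 := by positivity
    linarith
  · intro x hx
    have := norm_le_of_coord (gr P x) (cLoc d a * Mj d σ n (fun x => ‖gr P x‖) x) (fun i =>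
      local_val h n hn hf _ (hdeg i) (hcoord i) x hx)
    refine this.trans ?_
    rw [← mul_assoc]
    refine mul_le_mul_of_nonneg_right ?_ (hM0 x)
    have : 0 ≤ 1 + 4 ^ (d + 1) + 16 ^ (d + 1) + 2 * 2 ^ d * A + C1 := by positivity
    linarith
  · intro x y hx hy hxy
    have := norm_le_of_coord (gr P x - gr P y) _ (fun i =>
      local_lip h n hn hf _ (hdeg i) (hcoord i) x y hx hy hxy)
    refine this.trans ?_
    calc _ = C1 * (n * ‖x - y‖) * Mj d σ n (fun x => ‖gr P x‖) x := by rw [hC1]; ring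
      _ ≤ _ := by
        refine mul_le_mul_of_nonneg_right (mul_le_mul_of_nonneg_right ?_ (by positivity)) (hM0 x)
        have : 0 ≤ 1 + 4 ^ (d + 1) + 16 ^ (d + 1) + 2 * 2 ^ d * A + (d + 1) * cLoc d a := by
          positivity
        linarith

/-- Normalisation. -/
noncomputable def nrm {d : ℕ} (z : Ed d) : Ed d := ‖z‖⁻¹ • z

/-- Gradient of `ev P ∘ nrm`. -/
noncomputable def gu {d : ℕ} (P : MvPolynomial (Fin (d + 1)) ℝ) (z : Ed d) : Ed d :=
  ‖z‖⁻¹ • gr P (nrm z)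

lemma nrm_norm {d : ℕ} {z : Ed d} (hz : z ≠ 0) : ‖nrm z‖ = 1 := by
  unfold nrm
  rw [norm_smul, norm_inv, norm_norm, inv_mul_cancel₀ (norm_ne_zero_iff.2 hz)]

lemma ev_hasFDerivAt {d : ℕ} (P : MvPolynomial (Fin (d + 1)) ℝ) (x : Ed d) :
    HasFDerivAt (ev P) (∑ i, ev (MvPolynomial.pderiv i P) x •
      (EuclideanSpace.proj i : Ed d →L[ℝ] ℝ)) x := by
  induction P using MvPolynomial.induction_on with
  | C a =>
    have e : (ev (MvPolynomial.C a) : Ed d → ℝ) = fun _ => a := by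
      ext y; simp [ev]
    rw [e]
    refine (hasFDerivAt_const (𝕜 := ℝ) a x).congr_fderiv ?_
    simp [ev]
  | add p q hp hq =>
    have e : (ev (p + q) : Ed d → ℝ) = ev p + ev q := by
      ext y; simp [ev]
    rw [e]
    refine (hp.add hq).congr_fderiv ?_
    simp only [ev, map_add, add_smul, Finset.sum_add_distrib]
  | mul_X p j hp =>
    have h1 : HasFDerivAt (fun y : Ed d => y j) (EuclideanSpace.proj j : Ed d →L[ℝ] ℝ) x :=
      (EuclideanSpace.proj j : Ed d →L[ℝ] ℝ).hasFDerivAt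
    have e : (ev (p * MvPolynomial.X j) : Ed d → ℝ) = fun y => ev p y * y j := by
      ext y; simp [ev]
    rw [e]
    refine (hp.mul h1).congr_fderiv ?_
    ext v
    have h2 : ∀ i, MvPolynomial.eval (fun i => x i)
        (MvPolynomial.pderiv i (MvPolynomial.X (R := ℝ) j)) = if i = j then 1 else 0 := fun i => by
      rw [MvPolynomial.pderiv_X, Pi.single_apply]
      by_cases hij : i = j
      · simp [hij]
      · simp [hij, Ne.symm hij]
    simp [-MvPolynomial.pderiv_X, h2, Finset.mul_sum, add_mul, Finset.sum_add_distrib]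
    try ring_nf

lemma u_hasFDerivAt {d : ℕ} (P : MvPolynomial (Fin (d + 1)) ℝ) (z : Ed d) (hz : z ≠ 0) :
    HasFDerivAt (fun z => ev P (nrm z)) (innerSL ℝ (gu P z)) z := by
  have hz' : ‖z‖ ≠ 0 := norm_ne_zero_iff.2 hz
  have h1 : HasFDerivAt (fun z : Ed d => ‖z‖) (‖z‖⁻¹ • innerSL ℝ z) z := by
    have h2 := (HasFDerivAt.norm_sq (hasFDerivAt_id z)).sqrt (by simpa using hz')
    simp only [id, Real.sqrt_sq (norm_nonneg _)] at h2
    refine h2.congr_fderiv ?_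
    ext v
    simp
    field_simp
  have h3 : HasFDerivAt (fun z : Ed d => ‖z‖⁻¹) (-(‖z‖ ^ 2)⁻¹ • (‖z‖⁻¹ • innerSL ℝ z)) z :=
    (hasDerivAt_inv hz').comp_hasFDerivAt z h1
  have h4 := h3.smul (hasFDerivAt_id z)
  have h5 := (ev_hasFDerivAt P (nrm z)).comp z h4
  refine h5.congr_fderiv ?_
  ext v
  simp only [gu, gr, gp, nrm, innerSL_apply_apply, inner_smul_left, PiLp.inner_apply]
  simp [Finset.sum_add_distrib, Finset.mul_sum, sub_mul, mul_sub]
  have hD : ∀ i, ev (MvPolynomial.pderiv i P) (‖z‖⁻¹ • z) =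
      MvPolynomial.eval (fun i => ‖z‖⁻¹ * z i) (MvPolynomial.pderiv i P) := fun i => by
    simp [ev]
  simp only [hD]
  generalize (fun i => MvPolynomial.eval (fun i => ‖z‖⁻¹ * z i) (MvPolynomial.pderiv i P)) = D at *
  rw [sub_eq_add_neg]
  congr 1
  · exact Finset.sum_congr rfl fun i _ => by ring
  · congr 1
    rw [Finset.sum_comm]
    refine Finset.sum_congr rfl fun i _ => ?_
    rw [PiLp.inner_apply]
    simp only [Finset.mul_sum, Finset.sum_mul]
    refine Finset.sum_congr rfl fun j _ => ?_
    simp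
    ring

lemma norm_ge_half {d n : ℕ} (hn : 0 < n) {x z : Ed d} (hx : ‖x‖ = 1) (h : n * ‖z - x‖ ≤ 1 / 2) :
    ‖z - x‖ ≤ 1 / 2 ∧ 1 / 2 ≤ ‖z‖ ∧ |1 - ‖z‖| ≤ ‖z - x‖ ∧ z ≠ 0 ∧
      ‖x - nrm z‖ ≤ 2 * ‖z - x‖ := by
  have h1 : (1 : ℝ) ≤ n := by exact_mod_cast hn
  have h2 : ‖z - x‖ ≤ 1 / 2 := by nlinarith [norm_nonneg (z - x)]
  have h3 : |‖z‖ - ‖x‖| ≤ ‖z - x‖ := abs_norm_sub_norm_le z x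
  rw [hx, abs_sub_comm] at h3
  have h4 := abs_le.1 h3
  have hz : 1 / 2 ≤ ‖z‖ := by linarith [h4.2]
  have hz0 : z ≠ 0 := by
    rintro rfl
    simp at hz
    linarith
  refine ⟨h2, hz, h3, hz0, ?_⟩
  have h5 : ‖z - nrm z‖ = |1 - ‖z‖| := by
    have : z - nrm z = (1 - ‖z‖⁻¹) • z := by simp [nrm, sub_smul]
    rw [this, norm_smul, Real.norm_eq_abs]
    have hp : 0 < ‖z‖ := by linarith
    nth_rewrite 2 [← abs_of_pos hp]
    rw [← abs_mul, sub_mul, inv_mul_cancel₀ hp.ne', one_mul, abs_sub_comm]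
  calc ‖x - nrm z‖ ≤ ‖x - z‖ + ‖z - nrm z‖ := norm_sub_le_norm_sub_add_norm_sub x z _
    _ ≤ _ := by rw [h5, norm_sub_rev]; linarith

lemma gu_near {d : ℕ} {σ : Measure (Ed d)} {n : ℕ} (hn : 0 < n) {C : ℝ} (hC : 0 ≤ C)
    {P : MvPolynomial (Fin (d + 1)) ℝ} {M : Ed d → ℝ} (hM : GoodM d σ n C (gr P) M)
    (x z : Ed d) (hx : ‖x‖ = 1) (hz : n * ‖z - x‖ ≤ 1 / 2) :
    ‖gu P z - gr P x‖ ≤ 6 * C * n * ‖z - x‖ * M x := by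
  obtain ⟨h1, h2, h3, h4, h5⟩ := norm_ge_half hn hx hz
  have hn1 : (1 : ℝ) ≤ n := by exact_mod_cast hn
  have h6 := hM.glip x (nrm z) hx (nrm_norm h4) (by nlinarith)
  have h7 := hM.gle x hx
  have hM0 := hM.nonneg x
  have hp : 0 < ‖z‖ := by linarith
  have h8 : ‖z‖⁻¹ ≤ 2 := by
    rw [inv_le_comm₀ hp (by norm_num)]; linarith
  have h9 : |‖z‖⁻¹ - 1| ≤ 2 * ‖z - x‖ := by
    have : ‖z‖⁻¹ - 1 = ‖z‖⁻¹ * (1 - ‖z‖) := by field_simp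
    rw [this, abs_mul, abs_of_pos (inv_pos.2 hp)]
    gcongr
  have e : gu P z - gr P x = ‖z‖⁻¹ • (gr P (nrm z) - gr P x) + (‖z‖⁻¹ - 1) • gr P x := by
    simp only [gu, smul_sub, sub_smul, one_smul]; abel
  rw [e]
  refine (norm_add_le _ _).trans ?_
  rw [norm_smul, norm_smul, Real.norm_eq_abs, Real.norm_eq_abs, abs_of_pos (inv_pos.2 hp),
    norm_sub_rev (gr P (nrm z))]
  have a1 : ‖z‖⁻¹ * ‖gr P x - gr P (nrm z)‖ ≤ 2 * (C * (n * (2 * ‖z - x‖)) * M x) := by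
    refine mul_le_mul h8 (h6.trans ?_) (norm_nonneg _) (by norm_num)
    gcongr
  have a2 : |‖z‖⁻¹ - 1| * ‖gr P x‖ ≤ 2 * ‖z - x‖ * (C * M x) :=
    mul_le_mul h9 h7 (norm_nonneg _) (by positivity)
  have a3 : 2 * ‖z - x‖ * (C * M x) ≤ n * (2 * ‖z - x‖ * (C * M x)) :=
    le_mul_of_one_le_left (by positivity) hn1
  calc _ ≤ _ := add_le_add a1 (a2.trans a3)
    _ = _ := by ring

lemma u_taylor {d : ℕ} {σ : Measure (Ed d)} {n : ℕ} (hn : 0 < n) {C : ℝ} (hC : 0 ≤ C)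
    {P : MvPolynomial (Fin (d + 1)) ℝ} {M : Ed d → ℝ} (hM : GoodM d σ n C (gr P) M)
    (x z : Ed d) (hx : ‖x‖ = 1) (hz : n * ‖z - x‖ ≤ 1 / 2) :
    |ev P (nrm z) - ev P x - inner ℝ (gr P x) (z - x)| ≤ 6 * C * n * ‖z - x‖ ^ 2 * M x := by
  have hM0 := hM.nonneg x
  have key := Convex.norm_image_sub_le_of_norm_hasFDerivWithin_le' (𝕜 := ℝ)
    (f := fun z => ev P (nrm z)) (f' := fun z => innerSL ℝ (gu P z)) (φ := innerSL ℝ (gr P x))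
    (s := Metric.closedBall x ‖z - x‖) (C := 6 * C * n * ‖z - x‖ * M x) (x := x) (y := z)
    (fun y hy => (u_hasFDerivAt P y ?_).hasFDerivWithinAt) (fun y hy => ?_)
    (convex_closedBall _ _) (by simp) (by simp [dist_eq_norm])
  · have e : nrm x = x := by simp [nrm, hx]
    simp only [e, innerSL_apply_apply, Real.norm_eq_abs] at key
    refine key.trans (le_of_eq (by ring))
  · rw [Metric.mem_closedBall, dist_eq_norm] at hy
    exact (norm_ge_half hn hx (le_trans (by gcongr) hz)).2.2.2.1
  · rw [Metric.mem_closedBall, dist_eq_norm] at hy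
    rw [← map_sub, innerSL_apply_norm]
    refine (gu_near hn hC hM x y hx (le_trans (by gcongr) hz)).trans ?_
    gcongr

lemma P_lip {d : ℕ} {σ : Measure (Ed d)} {n : ℕ} (hn : 0 < n) {C : ℝ} (hC : 0 ≤ C)
    {P : MvPolynomial (Fin (d + 1)) ℝ} {M : Ed d → ℝ} (hM : GoodM d σ n C (gr P) M)
    (x y : Ed d) (hx : ‖x‖ = 1) (hy : ‖y‖ = 1) (hz : n * ‖x - y‖ ≤ 1 / 2) :
    |ev P x - ev P y| ≤ 4 * C * ‖x - y‖ * M x := by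
  have hM0 := hM.nonneg x
  rw [norm_sub_rev] at hz
  have h1 := u_taylor hn hC hM x y hx hz
  have e : nrm y = y := by simp [nrm, hy]
  rw [e] at h1
  have h2 : |inner ℝ (gr P x) (y - x)| ≤ C * M x * ‖y - x‖ :=
    (abs_real_inner_le_norm _ _).trans (by gcongr; exact hM.gle x hx)
  rw [norm_sub_rev x y, abs_sub_comm]
  have h3 : 6 * C * n * ‖y - x‖ ^ 2 * M x ≤ 3 * C * ‖y - x‖ * M x := by
    have : 0 ≤ 6 * C * ‖y - x‖ * M x := by positivity
    nlinarith
  have h4 : ev P y - ev P x = (ev P y - ev P x - inner ℝ (gr P x) (y - x)) +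
    inner ℝ (gr P x) (y - x) := by ring
  rw [h4]
  refine (abs_add_le _ _).trans ?_
  linarith

/-- Normalised gradient direction. -/
noncomputable def qd {d : ℕ} (g : Ed d → Ed d) (M : Ed d → ℝ) (x : Ed d) : Ed d := (M x)⁻¹ • g x

/-- The gain function. -/
noncomputable def hd {d : ℕ} (g : Ed d → Ed d) (M : Ed d → ℝ) (x : Ed d) : ℝ :=
  inner ℝ (g x) (qd g M x)

lemma qd_le {d : ℕ} {σ : Measure (Ed d)} {n : ℕ} {C : ℝ} (hC : 0 ≤ C)
    {g : Ed d → Ed d} {M : Ed d → ℝ} (hM : GoodM d σ n C g M) (x : Ed d) (hx : ‖x‖ = 1) :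
    ‖qd g M x‖ ≤ C := by
  unfold qd
  have h0 := hM.nonneg x
  rw [norm_smul, norm_inv, Real.norm_of_nonneg h0]
  rcases h0.eq_or_lt with h | h
  · rw [← h]; simpa using hC
  · rw [inv_mul_le_iff₀ h, mul_comm]
    exact hM.gle x hx

lemma qd_lip {d : ℕ} {σ : Measure (Ed d)} {n : ℕ} {C : ℝ} (hC : 1 ≤ C)
    {g : Ed d → Ed d} {M : Ed d → ℝ} (hM : GoodM d σ n C g M) (x y : Ed d) (hx : ‖x‖ = 1)
    (hy : ‖y‖ = 1) (hxy : n * ‖x - y‖ ≤ 1) :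
    ‖qd g M x - qd g M y‖ ≤ 2 * C ^ 2 * (n * ‖x - y‖) := by
  have h0 := hM.nonneg x
  rcases h0.eq_or_lt with h | h
  · have h1 := hM.zero x y h.symm
    simp only [qd, ← h, h1, inv_zero, zero_smul, sub_zero, norm_zero]
    positivity
  · have hy0 : 0 < M y := by
      rcases (hM.nonneg y).eq_or_lt with h' | h'
      · have := hM.zero y x h'.symm
        linarith
      · exact h'
    have e : qd g M x - qd g M y = (M x)⁻¹ • (g x - g y) + ((M x)⁻¹ * (M y - M x)) • qd g M y := by
      simp only [qd, smul_sub, smul_smul]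
      have : (M x)⁻¹ * (M y - M x) * (M y)⁻¹ = (M x)⁻¹ - (M y)⁻¹ := by field_simp
      rw [this, sub_smul]
      abel
    rw [e]
    refine (norm_add_le _ _).trans ?_
    rw [norm_smul, norm_smul, norm_mul, norm_inv, Real.norm_of_nonneg h0, Real.norm_eq_abs,
      abs_sub_comm]
    have a1 : (M x)⁻¹ * ‖g x - g y‖ ≤ C * (n * ‖x - y‖) := by
      rw [inv_mul_le_iff₀ h, mul_comm (M x)]
      exact hM.glip x y hx hy hxy
    have a2 : (M x)⁻¹ * |M x - M y| ≤ C * (n * ‖x - y‖) := by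
      rw [inv_mul_le_iff₀ h, mul_comm (M x)]
      exact hM.lip x y hxy
    have a3 := qd_le (by linarith) hM y hy
    have a4 : (M x)⁻¹ * |M x - M y| * ‖qd g M y‖ ≤ C * (n * ‖x - y‖) * C :=
      mul_le_mul a2 a3 (norm_nonneg _) (by positivity)
    have a5 : 0 ≤ n * ‖x - y‖ := by positivity
    nlinarith [mul_nonneg (mul_nonneg (by linarith : (0 : ℝ) ≤ C) (sub_nonneg.2 hC)) a5]

lemma hd_lip {d : ℕ} {σ : Measure (Ed d)} {n : ℕ} {C : ℝ} (hC : 1 ≤ C)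
    {g : Ed d → Ed d} {M : Ed d → ℝ} (hM : GoodM d σ n C g M) (x y : Ed d) (hx : ‖x‖ = 1)
    (hy : ‖y‖ = 1) (hxy : n * ‖x - y‖ ≤ 1) :
    |hd g M x - hd g M y| ≤ 3 * C ^ 4 * n * ‖x - y‖ * M x := by
  have h0 := hM.nonneg x
  have e : hd g M x - hd g M y =
      inner ℝ (g x - g y) (qd g M x) + inner ℝ (g y) (qd g M x - qd g M y) := by
    simp only [hd, inner_sub_left, inner_sub_right]; ring
  rw [e]
  refine (abs_add_le _ _).trans ?_
  have b1 : |inner ℝ (g x - g y) (qd g M x)| ≤ (C * (n * ‖x - y‖) * M x) * C :=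
    (abs_real_inner_le_norm _ _).trans (mul_le_mul (hM.glip x y hx hy hxy)
      (qd_le (by linarith) hM x hx) (norm_nonneg _) (by positivity))
  have b2 : |inner ℝ (g y) (qd g M x - qd g M y)| ≤ (C * (C * M x)) * (2 * C ^ 2 * (n * ‖x - y‖)) :=
    (abs_real_inner_le_norm _ _).trans (mul_le_mul ((hM.gle y hy).trans (by
      gcongr; exact hM.near x y hxy))
      (qd_lip hC hM x y hx hy hxy) (norm_nonneg _) (by positivity))
  have b3 : C ^ 2 ≤ C ^ 4 := pow_le_pow_right₀ hC (by norm_num)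
  have b4 : 0 ≤ n * ‖x - y‖ * M x := by positivity
  nlinarith [mul_le_mul_of_nonneg_right b3 b4]

lemma hd_continuous {d : ℕ} {σ : Measure (Ed d)} {n : ℕ} {C : ℝ}
    {g : Ed d → Ed d} (hg : Continuous g) {M : Ed d → ℝ} (hM : GoodM d σ n C g M) :
    Continuous (hd g M) := by
  by_cases h : M 0 = 0
  · have : hd g M = fun _ => 0 := by
      ext x
      simp [hd, qd, hM.zero 0 x h]
    rw [this]
    exact continuous_const
  · unfold hd qd
    refine hg.inner ((hM.cont.inv₀ fun x hx => h (hM.zero x 0 hx)).smul hg)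

lemma hd_integral {d : ℕ} {σ : Measure (Ed d)} {a A : ℝ} (h : Reg d σ a A) {n : ℕ} {C : ℝ}
    (hC : 1 ≤ C) {g : Ed d → Ed d} (hg : Continuous g) {M : Ed d → ℝ} (hM : GoodM d σ n C g M) :
    (∫ x, M x ∂σ) ≤ C ^ 2 * ∫ x, hd g M x ∂σ := by
  have h1 : ∫ x, (2 * C⁻¹ * ‖g x‖ - (C⁻¹) ^ 2 * M x) ∂σ ≤ ∫ x, hd g M x ∂σ := by
    refine integral_mono_ae ?_ (h.integrable (hd_continuous hg hM).continuousOn) ?_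
    · exact h.integrable (Continuous.continuousOn
        ((continuous_const.mul hg.norm).sub (continuous_const.mul hM.cont)))
    · filter_upwards [h.conc] with x hx
      have h0 := hM.nonneg x
      simp only [hd, qd, inner_smul_right, real_inner_self_eq_norm_sq]
      rcases h0.eq_or_lt with h' | h'
      · have := hM.gle x hx
        rw [← h', mul_zero] at this
        have := le_antisymm this (norm_nonneg _)
        simp [← h', this]
      · rw [inv_mul_eq_div, le_div_iff₀ h']
        nlinarith [sq_nonneg (‖g x‖ - C⁻¹ * M x)]
  rw [integral_sub, integral_const_mul, integral_const_mul] at h1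
  · have h2 := hM.int
    have hC0 : 0 < C := by linarith
    calc ∫ x, M x ∂σ ≤ 2 * C * ∫ x, ‖g x‖ ∂σ - ∫ x, M x ∂σ := by linarith
      _ = C ^ 2 * (2 * C⁻¹ * ∫ x, ‖g x‖ ∂σ - (C⁻¹) ^ 2 * ∫ x, M x ∂σ) := by field_simp
      _ ≤ _ := by gcongr
  · exact h.integrable (Continuous.continuousOn (continuous_const.mul hg.norm))
  · exact h.integrable (Continuous.continuousOn (continuous_const.mul hM.cont))

/-- Finite sets connected through `adj`. -/
inductive Conn {V : Type*} [DecidableEq V] (adj : V → V → Prop) : Finset V → Prop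
  | single (v : V) : Conn adj {v}
  | ins (S : Finset V) (u v : V) : Conn adj S → u ∈ S → v ∉ S → adj v u → Conn adj (insert v S)

lemma rounding {V : Type*} [DecidableEq V] {adj : V → V → Prop} {S : Finset V} (hS : Conn adj S) :
    ∀ (m : V → ℝ) (N : ℕ), (∀ v ∈ S, 0 ≤ m v) → ∑ v ∈ S, m v = N →
    ∃ (k : V → ℕ) (p : V → V), (∀ v ∈ S, p v ∈ S ∧ (p v = v ∨ adj v (p v))) ∧
      ∑ v ∈ S, k v = N ∧
      ∀ φ : V → ℝ, |∑ v ∈ S, (k v - m v) * φ v| ≤ ∑ v ∈ S, |φ v - φ (p v)| := by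
  induction hS with
  | single v =>
    intro m N h0 hs
    refine ⟨fun _ => N, id, ?_, ?_, ?_⟩
    · simp
    · simp
    · intro φ
      simp at hs
      simp [hs]
  | ins S u v hS hu hv hadj ih =>
    intro m N h0 hs
    rw [Finset.sum_insert hv] at hs
    have hm0 : 0 ≤ m v := h0 v (Finset.mem_insert_self _ _)
    set fl := ⌊m v⌋₊ with hfl
    have hfl1 : (fl : ℝ) ≤ m v := Nat.floor_le hm0
    have hfl2 : m v < fl + 1 := Nat.lt_floor_add_one _
    have hsum0 : 0 ≤ ∑ v ∈ S, m v :=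
      Finset.sum_nonneg fun w hw => h0 w (Finset.mem_insert_of_mem hw)
    have hflN : fl ≤ N := by
      have : (fl : ℝ) ≤ N := by linarith
      exact_mod_cast this
    have hvne : ∀ w ∈ S, w ≠ v := fun w hw h => hv (h ▸ hw)
    obtain ⟨k, p, h1, h2, h3⟩ := ih (fun w => m w + if w = u then m v - fl else 0) (N - fl)
      (fun w hw => by
        have := h0 w (Finset.mem_insert_of_mem hw)
        split_ifs <;> linarith)
      (by
        rw [Finset.sum_add_distrib, Finset.sum_ite_eq' S u, if_pos hu]
        push_cast [hflN]
        linarith)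
    refine ⟨Function.update k v fl, Function.update p v u, ?_, ?_, ?_⟩
    · intro w hw
      rcases Finset.mem_insert.1 hw with rfl | hw
      · simp [hu, hadj]
      · have hne : w ≠ v := fun h => hv (h ▸ hw)
        rw [Function.update_of_ne hne]
        exact ⟨Finset.mem_insert_of_mem (h1 w hw).1, (h1 w hw).2⟩
    · rw [Finset.sum_insert hv, Function.update_self]
      rw [Finset.sum_congr rfl (g := k) fun w hw =>
        Function.update_of_ne (hvne w hw) _ _, h2]
      omega
    · intro φ
      have e1 : ∑ w ∈ S, ((Function.update k v fl w : ℕ) - m w) * φ w =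
          ∑ w ∈ S, (k w - m w) * φ w :=
        Finset.sum_congr rfl fun w hw => by
          rw [Function.update_of_ne (hvne w hw)]
      have e2 : ∑ w ∈ S, |φ w - φ (Function.update p v u w)| = ∑ w ∈ S, |φ w - φ (p w)| :=
        Finset.sum_congr rfl fun w hw => by
          rw [Function.update_of_ne (hvne w hw)]
      rw [Finset.sum_insert hv, Finset.sum_insert hv, e1, e2, Function.update_self,
        Function.update_self]
      have h4 := h3 φ
      have e3 : ∑ w ∈ S, (k w - (m w + if w = u then m v - fl else 0)) * φ w =
          ∑ w ∈ S, (k w - m w) * φ w - (m v - fl) * φ u := by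
        have : ∀ w ∈ S, (k w - (m w + if w = u then m v - fl else 0)) * φ w =
          (k w - m w) * φ w - if w = u then (m v - fl) * φ w else 0 := fun w _ => by
          split_ifs <;> ring
        rw [Finset.sum_congr rfl this, Finset.sum_sub_distrib, Finset.sum_ite_eq' S u, if_pos hu]
      rw [e3] at h4
      have e4 : (fl - m v) * φ v + ∑ w ∈ S, (k w - m w) * φ w =
        (fl - m v) * (φ v - φ u) + (∑ w ∈ S, (k w - m w) * φ w - (m v - fl) * φ u) := by ring
      rw [e4]
      refine (abs_add_le _ _).trans (add_le_add ?_ h4)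
      rw [abs_mul]
      refine mul_le_of_le_one_left (abs_nonneg _) ?_
      rw [abs_le]
      constructor <;> linarith

lemma conn_net {d : ℕ} (hd : 1 ≤ d) (Z : Finset (Ed d)) (hZ : ∀ z ∈ Z, ‖z‖ = 1) (η : ℝ)
    (hη : 0 < η) (hcov : ∀ x : Ed d, ‖x‖ = 1 → ∃ z ∈ Z, ‖x - z‖ < η) [DecidableEq (Ed d)] :
    Conn (fun v u : Ed d => ‖v - u‖ ≤ 2 * η) Z := by
  classical
  have hpre : IsPreconnected (Metric.sphere (0 : Ed d) 1) := by
    refine isPreconnected_sphere ?_ _ _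
    rw [rank_eq_card_basis (EuclideanSpace.basisFun (Fin (d + 1)) ℝ).toBasis]
    simp
    exact_mod_cast hd
  obtain ⟨e, he⟩ : ∃ e : Ed d, ‖e‖ = 1 := ⟨EuclideanSpace.single 0 1, by simp⟩
  obtain ⟨z0, hz0, -⟩ := hcov e he
  obtain ⟨T, hT⟩ := Finset.exists_maximal
    (s := Z.powerset.filter (fun T => Conn (fun v u : Ed d => ‖v - u‖ ≤ 2 * η) T))
    ⟨{z0}, by simp [hz0]; exact Conn.single z0⟩
  have hTm := hT.1
  simp only [Finset.mem_filter, Finset.mem_powerset] at hTm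
  obtain ⟨hTZ, hTc⟩ := hTm
  have hfar : ∀ u ∈ T, ∀ v ∈ Z \ T, 2 * η < ‖v - u‖ := by
    intro u hu v hv
    by_contra! hcon
    rw [Finset.mem_sdiff] at hv
    have h1 := Conn.ins T u v hTc hu hv.2 hcon
    have h2 : insert v T ≤ T := hT.2 (by
      simp only [Finset.mem_filter, Finset.mem_powerset]
      exact ⟨Finset.insert_subset hv.1 hTZ, h1⟩) (Finset.subset_insert _ _)
    exact hv.2 (h2 (Finset.mem_insert_self _ _))
  have hTne : T.Nonempty := by
    cases hTc with
    | single v => simp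
    | ins => simp
  suffices hTe : Z ⊆ T by
    rw [Finset.Subset.antisymm hTZ hTe] at hTc
    exact hTc
  intro v hv
  by_contra hvT
  have hvZ : v ∈ Z \ T := Finset.mem_sdiff.2 ⟨hv, hvT⟩
  have hcl : ∀ W : Finset (Ed d), IsClosed (⋃ u ∈ W, Metric.closedBall u η) := fun W =>
    Set.Finite.isClosed_biUnion (Finset.finite_toSet W) fun u _ => Metric.isClosed_closedBall
  obtain ⟨u, hu⟩ := hTne
  have h5 := isPreconnected_closed_iff.1 hpre _ _ (hcl T) (hcl (Z \ T)) ?_ ?_ ?_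
  · obtain ⟨x, -, hx1, hx2⟩ := h5
    simp only [Set.mem_iUnion, Metric.mem_closedBall, dist_eq_norm] at hx1 hx2
    obtain ⟨u1, hu1, hxu⟩ := hx1
    obtain ⟨v1, hv1, hxv⟩ := hx2
    have := hfar u1 hu1 v1 hv1
    have h6 : ‖v1 - u1‖ ≤ ‖v1 - x‖ + ‖x - u1‖ := norm_sub_le_norm_sub_add_norm_sub _ _ _
    rw [norm_sub_rev v1 x] at h6
    linarith
  · intro x hx
    obtain ⟨z, hz, hxz⟩ := hcov x (by simpa using hx)
    by_cases hzT : z ∈ T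
    · left
      simp only [Set.mem_iUnion, Metric.mem_closedBall, dist_eq_norm]
      exact ⟨z, hzT, hxz.le⟩
    · right
      simp only [Set.mem_iUnion, Metric.mem_closedBall, dist_eq_norm]
      exact ⟨z, Finset.mem_sdiff.2 ⟨hz, hzT⟩, hxz.le⟩
  · refine ⟨u, by simpa using hZ u (hTZ hu), ?_⟩
    simp only [Set.mem_iUnion, Metric.mem_closedBall, dist_eq_norm]
    exact ⟨u, hu, by simpa using hη.le⟩
  · refine ⟨v, by simpa using hZ v hv, ?_⟩
    simp only [Set.mem_iUnion, Metric.mem_closedBall, dist_eq_norm]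
    exact ⟨v, hvZ, by simpa using hη.le⟩

lemma packing_count {d : ℕ} {σ : Measure (Ed d)} {a A : ℝ} (h : Reg d σ a A)
    (T : Finset (Ed d)) (hT : ∀ z ∈ T, ‖z‖ = 1) (s : ℝ) (hs : 0 < s) (hs1 : s ≤ 1)
    (hsep : ∀ z ∈ T, ∀ w ∈ T, z ≠ w → s ≤ ‖z - w‖) (x : Ed d) (hx : ‖x‖ = 1) (R : ℝ) (hR : 0 < R)
    (hTR : ∀ z ∈ T, ‖z - x‖ ≤ R) :
    T.card * (a * (s / 3) ^ d) ≤ A * (R + s) ^ d := by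
  have hprob := h.prob
  have hdis : Set.PairwiseDisjoint (T : Set (Ed d)) (fun z => Metric.closedBall z (s / 3)) := by
    intro z hz w hw hzw
    refine Metric.closedBall_disjoint_closedBall ?_
    rw [dist_eq_norm]
    have := hsep z hz w hw hzw
    linarith
  have h1 : ∑ z ∈ T, σ.real (Metric.closedBall z (s / 3)) ≤ σ.real (Metric.closedBall x (R + s)) := by
    rw [← measureReal_biUnion_finset hdis (fun z _ => Metric.isClosed_closedBall.measurableSet)]
    refine measureReal_mono ?_
    refine Set.iUnion₂_subset fun z hz => ?_
    refine Metric.closedBall_subset_closedBall' ?_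
    rw [dist_eq_norm]
    have := hTR z hz
    linarith
  have h2 : T.card * (a * (s / 3) ^ d) ≤ ∑ z ∈ T, σ.real (Metric.closedBall z (s / 3)) := by
    rw [← nsmul_eq_mul]
    refine Finset.card_nsmul_le_sum _ _ _ fun z hz => ?_
    exact h.lower z (hT z hz) _ (by positivity) (by linarith)
  exact (h2.trans h1).trans (h.upper x hx _ (by positivity))

lemma exists_packing {d : ℕ} {σ : Measure (Ed d)} {a A : ℝ} (h : Reg d σ a A)
    (U : Set (Ed d)) (hU : ∀ z ∈ U, ‖z‖ = 1) (s : ℝ) (hs : 0 < s) (hs1 : s ≤ 1) :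
    ∃ T : Finset (Ed d), (∀ z ∈ T, z ∈ U) ∧ (∀ z ∈ T, ∀ w ∈ T, z ≠ w → s ≤ ‖z - w‖) ∧
      ∀ x ∈ U, ∃ z ∈ T, ‖x - z‖ < s := by
  classical
  obtain ⟨e, he⟩ : ∃ e : Ed d, ‖e‖ = 1 := ⟨EuclideanSpace.single 0 1, by simp⟩
  have ha := h.ha
  let Q : ℕ → Prop := fun k => ∃ T : Finset (Ed d), T.card = k ∧ (∀ z ∈ T, z ∈ U) ∧
    (∀ z ∈ T, ∀ w ∈ T, z ≠ w → s ≤ ‖z - w‖)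
  set b := ⌈A * (2 + s) ^ d / (a * (s / 3) ^ d)⌉₊ with hb
  have hQ0 : Q 0 := ⟨∅, by simp⟩
  have hbd : ∀ T : Finset (Ed d), (∀ z ∈ T, z ∈ U) → 
    (∀ z ∈ T, ∀ w ∈ T, z ≠ w → s ≤ ‖z - w‖) → T.card ≤ b := by
    intro T h1 h2
    have h3 := packing_count h T (fun z hz => hU z (h1 z hz)) s hs hs1 h2 e he 2 (by norm_num)
      (fun z hz => (norm_sub_le _ _).trans (by rw [hU z (h1 z hz), he]; norm_num))
    rw [← le_div_iff₀ (by positivity)] at h3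
    exact_mod_cast h3.trans (Nat.le_ceil _)
  have hk : Q (Nat.findGreatest Q b) := Nat.findGreatest_spec (Nat.zero_le b) hQ0
  obtain ⟨T, hTc, hTU, hTs⟩ := hk
  refine ⟨T, hTU, hTs, fun x hx => ?_⟩
  by_contra! hcon
  have hxT : x ∉ T := fun hxT => by
    have := hcon x hxT
    simp at this
    linarith
  have h1 : ∀ z ∈ insert x T, z ∈ U := by
    intro z hz
    rcases Finset.mem_insert.1 hz with rfl | hz
    · exact hx
    · exact hTU z hz
  have h2 : ∀ z ∈ insert x T, ∀ w ∈ insert x T, z ≠ w → s ≤ ‖z - w‖ := by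
    intro z hz w hw hzw
    rcases Finset.mem_insert.1 hz with rfl | hz'
    · rcases Finset.mem_insert.1 hw with rfl | hw
      · exact absurd rfl hzw
      · exact hcon w hw
    · rcases Finset.mem_insert.1 hw with rfl | hw
      · rw [norm_sub_rev]; exact hcon z hz'
      · exact hTs z hz' w hw hzw
  have h3 := Nat.le_findGreatest (P := Q) (hbd _ h1 h2) ⟨_, rfl, h1, h2⟩
  rw [← hTc, Finset.card_insert_of_notMem hxT] at h3
  omega

/-- Many separated points in a cap. -/
lemma cap_points {d : ℕ} {σ : Measure (Ed d)} {a A : ℝ} (h : Reg d σ a A)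
    (z : Ed d) (hz : ‖z‖ = 1) (ρ s : ℝ) (hρ : 0 < ρ) (hρ1 : ρ ≤ 1) (hs : 0 < s) (hs1 : s ≤ 1)
    (k : ℕ) (hk : k * (A * s ^ d) ≤ a * ρ ^ d) :
    ∃ T : Finset (Ed d), T.card = k ∧ (∀ y ∈ T, ‖y‖ = 1 ∧ ‖y - z‖ ≤ ρ) ∧
      (∀ y ∈ T, ∀ w ∈ T, y ≠ w → s ≤ ‖y - w‖) := by
  have hprob := h.prob
  have hA := h.hA
  obtain ⟨T, hT1, hT2, hT3⟩ := exists_packing h {y | ‖y‖ = 1 ∧ ‖y - z‖ ≤ ρ} (fun y hy => hy.1)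
    s hs hs1
  have hcard : k ≤ T.card := by
    have h1 : σ.real (Metric.closedBall z ρ) ≤ σ.real (⋃ y ∈ T, Metric.closedBall y s) := by
      refine ENNReal.toReal_mono (measure_ne_top _ _) (measure_mono_ae ?_)
      filter_upwards [h.conc] with x hx hxz
      have hxz' : ‖x - z‖ ≤ ρ := by
        rw [← dist_eq_norm]; exact hxz
      obtain ⟨y, hy, hxy⟩ := hT3 x ⟨hx, hxz'⟩
      have : x ∈ ⋃ y ∈ T, Metric.closedBall y s := by
        simp only [Set.mem_iUnion, Metric.mem_closedBall, dist_eq_norm]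
        exact ⟨y, hy, hxy.le⟩
      exact this
    have h2 : σ.real (⋃ y ∈ T, Metric.closedBall y s) ≤ ∑ y ∈ T, σ.real (Metric.closedBall y s) :=
      measureReal_biUnion_finset_le _ _
    have h3 : ∑ y ∈ T, σ.real (Metric.closedBall y s) ≤ T.card * (A * s ^ d) := by
      rw [← nsmul_eq_mul]
      exact Finset.sum_le_card_nsmul _ _ _ fun y hy => h.upper y (hT1 y hy).1 s hs
    have h4 := h.lower z hz ρ hρ hρ1
    have h5 : k * (A * s ^ d) ≤ T.card * (A * s ^ d) := by linarith
    have h6 := le_of_mul_le_mul_right h5 (by positivity)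
    exact_mod_cast h6
  obtain ⟨T', hT', hc⟩ := Finset.exists_subset_card_eq hcard
  exact ⟨T', hc, fun y hy => hT1 y (hT' hy), fun y hy w hw => hT2 y (hT' hy) w (hT' hw)⟩

lemma exists_weights {d : ℕ} (Z : Finset (Ed d)) (η : ℝ) 
    (hcov : ∀ x : Ed d, ‖x‖ = 1 → ∃ z ∈ Z, ‖x - z‖ < η) :
    ∃ w : Ed d → Ed d → ℝ, (∀ z, ContinuousOn (w z) (Metric.sphere 0 1)) ∧
      (∀ z x, 0 ≤ w z x) ∧ (∀ z x, η < ‖x - z‖ → w z x = 0) ∧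
      ∀ x : Ed d, ‖x‖ = 1 → ∑ z ∈ Z, w z x = 1 := by
  let b : Ed d → Ed d → ℝ := fun z x => max 0 (η - ‖x - z‖)
  have hb0 : ∀ z x, 0 ≤ b z x := fun z x => le_max_left _ _
  have hbc : ∀ z, Continuous (b z) := fun z => by
    show Continuous fun x => max 0 (η - ‖x - z‖)
    fun_prop
  have hW : ∀ x : Ed d, ‖x‖ = 1 → 0 < ∑ z ∈ Z, b z x := by
    intro x hx
    obtain ⟨z, hz, hxz⟩ := hcov x hx
    refine Finset.sum_pos' (fun z _ => hb0 z x) ⟨z, hz, ?_⟩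
    exact lt_max_of_lt_right (by linarith)
  refine ⟨fun z x => b z x / ∑ z ∈ Z, b z x, ?_, ?_, ?_, ?_⟩
  · intro z
    refine (hbc z).continuousOn.div (continuous_finsetSum _ fun z _ => hbc z).continuousOn ?_
    intro x hx
    exact (hW x (by simpa using hx)).ne'
  · intro z x
    exact div_nonneg (hb0 z x) (Finset.sum_nonneg fun z _ => hb0 z x)
  · intro z x hx
    have : b z x = 0 := max_eq_left (by linarith)
    simp [this]
  · intro x hx
    simp only
    rw [← Finset.sum_div, div_self (hW x hx).ne']

lemma sum_M_le {d : ℕ} {σ : Measure (Ed d)} {a A : ℝ} (h : Reg d σ a A)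
    (Z : Finset (Ed d)) (hZ : ∀ z ∈ Z, ‖z‖ = 1) (η : ℝ) (hη : 0 < η) (hη1 : η ≤ 1)
    (hsep : ∀ z ∈ Z, ∀ w ∈ Z, z ≠ w → η ≤ ‖z - w‖) (M : Ed d → ℝ) (hM : Continuous M)
    (hM0 : ∀ x, 0 ≤ M x) (L : ℝ)
    (hL : ∀ x z : Ed d, ‖x‖ = 1 → ‖z‖ = 1 → ‖x - z‖ ≤ η → M z ≤ L * M x) (hL0 : 0 ≤ L) :
    η ^ d * ∑ z ∈ Z, M z ≤ 3 ^ d / a * L * ∫ x, M x ∂σ := by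
  have hprob := h.prob
  have ha := h.ha
  have hMi : Integrable M σ := h.integrable hM.continuousOn
  have hdis : Set.Pairwise (Z : Set (Ed d)) (Function.onFun Disjoint
      (fun z => Metric.closedBall z (η / 3))) := by
    intro z hz w hw hzw
    refine Metric.closedBall_disjoint_closedBall ?_
    rw [dist_eq_norm]
    have := hsep z hz w hw hzw
    linarith
  have h1 : ∀ z ∈ Z, a * (η / 3) ^ d * M z ≤ ∫ x in Metric.closedBall z (η / 3), L * M x ∂σ := by
    intro z hz
    have h2 := h.lower z (hZ z hz) (η / 3) (by positivity) (by linarith)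
    calc a * (η / 3) ^ d * M z ≤ σ.real (Metric.closedBall z (η / 3)) * M z :=
          mul_le_mul_of_nonneg_right h2 (hM0 z)
      _ = ∫ x in Metric.closedBall z (η / 3), M z ∂σ := by
          rw [setIntegral_const, smul_eq_mul]
      _ ≤ _ := by
        refine setIntegral_mono_on_ae (integrable_const _).integrableOn
          (hMi.const_mul L).integrableOn Metric.isClosed_closedBall.measurableSet ?_
        filter_upwards [h.conc] with x hx hxz
        rw [Metric.mem_closedBall, dist_eq_norm] at hxz
        exact hL x z hx (hZ z hz) (by linarith)
  have h3 := Finset.sum_le_sum h1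
  rw [← integral_biUnion_finset Z (fun z _ => Metric.isClosed_closedBall.measurableSet) hdis
    (fun z _ => (hMi.const_mul L).integrableOn), ← Finset.mul_sum] at h3
  have h4 : ∫ x in ⋃ z ∈ Z, Metric.closedBall z (η / 3), L * M x ∂σ ≤ ∫ x, L * M x ∂σ :=
    setIntegral_le_integral (hMi.const_mul L) (Filter.Eventually.of_forall fun x =>
      mul_nonneg hL0 (hM0 x))
  have h5 := h3.trans h4
  rw [integral_const_mul] at h5
  calc η ^ d * ∑ z ∈ Z, M z = 3 ^ d / a * (a * (η / 3) ^ d * ∑ z ∈ Z, M z) := by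
        rw [div_pow]; field_simp
    _ ≤ 3 ^ d / a * (L * ∫ x, M x ∂σ) := by gcongr
    _ = _ := by ring

lemma weights_quad {d : ℕ} {σ : Measure (Ed d)} {a A : ℝ} (h : Reg d σ a A)
    (Z : Finset (Ed d)) (hZ : ∀ z ∈ Z, ‖z‖ = 1) (η : ℝ)
    (w : Ed d → Ed d → ℝ) (hw1 : ∀ z, ContinuousOn (w z) (Metric.sphere 0 1))
    (hw2 : ∀ z x, 0 ≤ w z x) (hw3 : ∀ z x, η < ‖x - z‖ → w z x = 0)
    (hw4 : ∀ x : Ed d, ‖x‖ = 1 → ∑ z ∈ Z, w z x = 1)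
    (φ M : Ed d → ℝ) (hφ : Continuous φ) (hM : Continuous M) (hM0 : ∀ x, 0 ≤ M x) (B : ℝ)
    (hB : 0 ≤ B)
    (hl : ∀ x z : Ed d, ‖x‖ = 1 → ‖z‖ = 1 → ‖x - z‖ ≤ η → |φ x - φ z| ≤ B * ‖x - z‖ * M x) :
    |∑ z ∈ Z, (∫ x, w z x ∂σ) * φ z - ∫ x, φ x ∂σ| ≤ B * η * ∫ x, M x ∂σ := by
  have hprob := h.prob
  have hwi : ∀ z, Integrable (w z) σ := fun z => h.integrable (hw1 z)
  have e1 : ∑ z ∈ Z, (∫ x, w z x ∂σ) * φ z = ∫ x, ∑ z ∈ Z, w z x * φ z ∂σ := by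
    rw [integral_finsetSum _ (fun z _ => (hwi z).mul_const _)]
    exact Finset.sum_congr rfl fun z _ => (integral_mul_const _ _).symm
  have hi : Integrable (fun x => ∑ z ∈ Z, w z x * φ z) σ :=
    integrable_finsetSum _ (fun z _ => (hwi z).mul_const _)
  have hφi : Integrable φ σ := h.integrable hφ.continuousOn
  have hMi : Integrable M σ := h.integrable hM.continuousOn
  rw [e1, ← integral_sub hi hφi, ← integral_const_mul, ← Real.norm_eq_abs]
  refine norm_integral_le_of_norm_le (hMi.const_mul _) ?_
  filter_upwards [h.conc] with x hx
  have e2 : ∑ z ∈ Z, w z x * φ z - φ x = ∑ z ∈ Z, w z x * (φ z - φ x) := by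
    simp only [mul_sub, Finset.sum_sub_distrib]
    rw [← Finset.sum_mul, hw4 x hx, one_mul]
  rw [e2, Real.norm_eq_abs]
  refine (Finset.abs_sum_le_sum_abs _ _).trans ?_
  calc ∑ z ∈ Z, |w z x * (φ z - φ x)| ≤ ∑ z ∈ Z, w z x * (B * η * M x) := by
        refine Finset.sum_le_sum fun z hz => ?_
        rw [abs_mul, abs_of_nonneg (hw2 z x)]
        by_cases hxz : ‖x - z‖ ≤ η
        · refine mul_le_mul_of_nonneg_left ?_ (hw2 z x)
          rw [abs_sub_comm]
          refine (hl x z hx (hZ z hz) hxz).trans ?_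
          have := hM0 x
          gcongr
        · rw [hw3 z x (not_le.1 hxz)]; simp
    _ = _ := by rw [← Finset.sum_mul, hw4 x hx, one_mul]

theorem discretize {d : ℕ} (hd : 1 ≤ d) {σ : Measure (Ed d)} {a A : ℝ} (h : Reg d σ a A) :
    ∃ K : ℝ, 0 < K ∧ ∀ r : ℝ, 0 < r → r ≤ 1 → ∃ Cr β : ℝ, 0 < Cr ∧ 0 < β ∧
      ∀ n N : ℕ, 0 < n → Cr * (n : ℝ) ^ d ≤ N → ∃ x : Fin N → Ed d, (∀ i, ‖x i‖ = 1) ∧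
        (∀ i j, i ≠ j → β * (N : ℝ) ^ (-(1 : ℝ) / d) ≤ ‖x i - x j‖) ∧
        ∀ (φ M : Ed d → ℝ) (L B : ℝ), Continuous φ → Continuous M → (∀ x, 0 ≤ M x) → 0 ≤ B →
          1 ≤ L → (∀ x y : Ed d, ‖x‖ = 1 → ‖y‖ = 1 → n * ‖x - y‖ ≤ 1 / 2 → M y ≤ L * M x) →
          (∀ x y : Ed d, ‖x‖ = 1 → ‖y‖ = 1 → n * ‖x - y‖ ≤ 1 / 2 →
            |φ x - φ y| ≤ B * ‖x - y‖ * M x) →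
          |(N : ℝ)⁻¹ * ∑ i, φ (x i) - ∫ x, φ x ∂σ| ≤ K * L * B * (r / n) * ∫ x, M x ∂σ := by
  classical
  have hprob := h.prob
  have ha := h.ha
  have hA := h.hA
  obtain ⟨K1, hK1d⟩ : ∃ K1, K1 = A + 1 + 9 ^ d * A / a := ⟨_, rfl⟩
  have hK1 : 0 < K1 := by rw [hK1d]; positivity
  refine ⟨1 + (K1 + 2) * (3 ^ d / a), by positivity, fun r hr hr1 => ?_⟩
  obtain ⟨β, hβd⟩ : ∃ β, β = min (1 / 2) (a / (4 ^ d * A * K1)) := ⟨_, rfl⟩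
  have hβ : 0 < β := by rw [hβd]; exact lt_min (by norm_num) (by positivity)
  have hβ2 : β ≤ 1 / 2 := by rw [hβd]; exact min_le_left _ _
  have hβd' : β ^ d * (4 ^ d * A * K1) ≤ a := by
    have h1 : β ^ d ≤ β := by
      calc β ^ d ≤ β ^ 1 := pow_le_pow_of_le_one hβ.le (by linarith) hd
        _ = β := pow_one β
    have h2 : β ≤ a / (4 ^ d * A * K1) := by rw [hβd]; exact min_le_right _ _
    rw [← le_div_iff₀ (by positivity)]
    linarith
  refine ⟨(8 / r) ^ d, β, by positivity, hβ, fun n N hn hN => ?_⟩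
  have hn0 : (0 : ℝ) < n := by exact_mod_cast hn
  have hn1 : (1 : ℝ) ≤ n := by exact_mod_cast hn
  obtain ⟨η, hηd⟩ : ∃ η, η = r / (8 * n) := ⟨_, rfl⟩
  have hη : 0 < η := by rw [hηd]; positivity
  have hnη : n * η = r / 8 := by rw [hηd]; field_simp
  have hη1 : η ≤ 1 / 8 := by nlinarith
  have hNη : 1 ≤ N * η ^ d := by
    have : (8 / r) ^ d * (n : ℝ) ^ d * η ^ d = 1 := by
      rw [← mul_pow, ← mul_pow, mul_assoc, hnη]
      field_simp
      simp
    calc (1 : ℝ) = _ := this.symm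
      _ ≤ _ := by gcongr
  have hNpos : (0 : ℝ) < N := by
    by_contra! hcon
    have : (N : ℝ) = 0 := le_antisymm hcon (Nat.cast_nonneg N)
    rw [this] at hNη
    linarith
  obtain ⟨ν, hνd⟩ : ∃ ν : ℝ, ν = (N : ℝ) ^ (-(1 : ℝ) / d) := ⟨_, rfl⟩
  have hν : 0 < ν := by rw [hνd]; positivity
  have hνp : ν ^ d = (N : ℝ)⁻¹ := by
    rw [hνd, ← Real.rpow_natCast, ← Real.rpow_mul hNpos.le, div_mul_cancel₀, Real.rpow_neg_one]
    have : d ≠ 0 := by omega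
    exact_mod_cast this
  have hνη : ν ≤ η := by
    by_contra! hcon
    have h1 : η ^ d < ν ^ d := pow_lt_pow_left₀ hcon hη.le (by omega)
    rw [hνp] at h1
    have h2 : N * η ^ d < N * (N : ℝ)⁻¹ := by gcongr
    rw [mul_inv_cancel₀ hNpos.ne'] at h2
    linarith
  obtain ⟨Z, hZ1, hZsep, hZcov⟩ := exists_packing h {x | ‖x‖ = 1} (fun z hz => hz) η hη
    (by linarith)
  have hZ1 : ∀ z ∈ Z, ‖z‖ = 1 := hZ1
  have hZcov : ∀ x : Ed d, ‖x‖ = 1 → ∃ z ∈ Z, ‖x - z‖ < η := hZcov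
  have hconn := conn_net hd Z hZ1 η hη hZcov
  obtain ⟨w, hw1, hw2, hw3, hw4⟩ := exists_weights Z η hZcov
  have hsw : ∑ z ∈ Z, (∫ x, w z x ∂σ) = 1 := by
    rw [← integral_finsetSum _ (fun z _ => h.integrable (hw1 z))]
    have : (fun x => ∑ z ∈ Z, w z x) =ᵐ[σ] fun _ => (1 : ℝ) := by
      filter_upwards [h.conc] with x hx using hw4 x hx
    rw [integral_congr_ae this]
    simp
  obtain ⟨k, p, hp, hkN, hround⟩ := rounding hconn (fun z => N * ∫ x, w z x ∂σ) N
    (fun z _ => mul_nonneg hNpos.le (integral_nonneg (hw2 z)))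
    (by rw [← Finset.mul_sum, hsw, mul_one])
  have hpd : ∀ z ∈ Z, ‖z - p z‖ ≤ 2 * η := by
    intro z hz
    rcases (hp z hz).2 with h1 | h1
    · rw [h1]; simp; linarith
    · exact h1
  -- upper bound for `k`
  have hk : ∀ z ∈ Z, (k z : ℝ) ≤ K1 * (N * η ^ d) := by
    intro z hz
    have h1 := hround (fun v => if v = z then 1 else 0)
    have h2 : ∑ v ∈ Z, ((k v : ℝ) - N * ∫ x, w v x ∂σ) * (if v = z then 1 else 0) =
        k z - N * ∫ x, w z x ∂σ := by
      simp [hz]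
    rw [h2] at h1
    have h3 : ∑ v ∈ Z, |(if v = z then (1 : ℝ) else 0) - (if p v = z then 1 else 0)| ≤
        1 + (Z.filter (fun v => ‖v - z‖ ≤ 2 * η)).card := by
      calc _ ≤ ∑ v ∈ Z, ((if v = z then (1 : ℝ) else 0) + (if ‖v - z‖ ≤ 2 * η then 1 else 0)) := by
            refine Finset.sum_le_sum fun v hv => ?_
            have h4 : (if p v = z then (1 : ℝ) else 0) ≤ if ‖v - z‖ ≤ 2 * η then 1 else 0 := by
              split_ifs with h5 h6 h6
              · exact le_rfl
              · exact absurd (h5 ▸ hpd v hv) h6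
              · norm_num
              · exact le_rfl
            refine (abs_sub _ _).trans ?_
            rw [abs_of_nonneg (by split_ifs <;> norm_num), abs_of_nonneg (by split_ifs <;> norm_num)]
            linarith
        _ = _ := by
          rw [Finset.sum_add_distrib, Finset.sum_ite_eq' Z z, if_pos hz, Finset.sum_boole]
    have h4 : ((Z.filter (fun v => ‖v - z‖ ≤ 2 * η)).card : ℝ) ≤ 9 ^ d * A / a := by
      have h5 := packing_count h (Z.filter (fun v => ‖v - z‖ ≤ 2 * η))
        (fun v hv => hZ1 v (Finset.mem_filter.1 hv).1) η hη (by linarith)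
        (fun v hv u hu => hZsep v (Finset.mem_filter.1 hv).1 u (Finset.mem_filter.1 hu).1)
        z (hZ1 z hz) (2 * η) (by positivity) (fun v hv => (Finset.mem_filter.1 hv).2)
      rw [le_div_iff₀ ha]
      have h6 : 0 < (η / 3) ^ d := by positivity
      have h7 : A * (2 * η + η) ^ d = 9 ^ d * A * (η / 3) ^ d := by
        rw [show 2 * η + η = 9 * (η / 3) by ring, mul_pow]; ring
      rw [h7, ← mul_assoc] at h5
      exact le_of_mul_le_mul_right h5 h6
    have h5 : ∫ x, w z x ∂σ ≤ A * η ^ d := by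
      refine le_trans ?_ (h.upper z (hZ1 z hz) η hη)
      rw [← integral_indicator_one Metric.isClosed_closedBall.measurableSet]
      refine integral_mono_ae (h.integrable (hw1 z))
        ((integrable_const _).indicator Metric.isClosed_closedBall.measurableSet) ?_
      filter_upwards [h.conc] with x hx
      by_cases hxz : x ∈ Metric.closedBall z η
      · rw [Set.indicator_of_mem hxz]
        have := Finset.single_le_sum (f := fun z => w z x) (fun z _ => hw2 z x) hz
        rw [hw4 x hx] at this
        simpa using this
      · rw [Set.indicator_of_notMem hxz, hw3 z x]
        rw [Metric.mem_closedBall, dist_eq_norm] at hxz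
        exact not_le.1 hxz
    have h6 := (abs_le.1 (h1.trans (h3.trans (add_le_add_right h4 1)))).2
    have h7 : N * ∫ x, w z x ∂σ ≤ N * (A * η ^ d) := by gcongr
    have h8 : 0 ≤ 1 + 9 ^ d * A / a := by positivity
    calc (k z : ℝ) ≤ N * (A * η ^ d) + (1 + 9 ^ d * A / a) * 1 := by linarith
      _ ≤ N * (A * η ^ d) + (1 + 9 ^ d * A / a) * (N * η ^ d) := by gcongr
      _ = _ := by rw [hK1d]; ring
  -- the points
  have hT : ∀ z ∈ Z, ∃ T : Finset (Ed d), T.card = k z ∧ (∀ y ∈ T, ‖y‖ = 1 ∧ ‖y - z‖ ≤ η / 4) ∧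
      (∀ y ∈ T, ∀ w ∈ T, y ≠ w → β * ν ≤ ‖y - w‖) := by
    intro z hz
    refine cap_points h z (hZ1 z hz) (η / 4) (β * ν) (by positivity) (by linarith) (by positivity)
      (by nlinarith) (k z) ?_
    calc k z * (A * (β * ν) ^ d) ≤ K1 * (N * η ^ d) * (A * (β * ν) ^ d) := by
          gcongr; exact hk z hz
      _ = (β ^ d * (4 ^ d * A * K1)) * (η / 4) ^ d := by
          rw [mul_pow, hνp, div_pow]; field_simp
      _ ≤ _ := by gcongr
  choose! T hT1 hT2 hT3 using hT
  have hcross : ∀ z ∈ Z, ∀ z' ∈ Z, z ≠ z' → ∀ y ∈ T z, ∀ y' ∈ T z', η / 2 ≤ ‖y - y'‖ := by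
    intro z hz z' hz' hne y hy y' hy'
    have h1 := hZsep z hz z' hz' hne
    have h2 := (hT2 z hz y hy).2
    have h3 := (hT2 z' hz' y' hy').2
    have h4 : ‖z - z'‖ ≤ ‖z - y‖ + ‖y - z'‖ := norm_sub_le_norm_sub_add_norm_sub _ _ _
    have h5 : ‖y - z'‖ ≤ ‖y - y'‖ + ‖y' - z'‖ := norm_sub_le_norm_sub_add_norm_sub _ _ _
    rw [norm_sub_rev z y] at h4
    linarith
  have hdisj : (Z : Set (Ed d)).PairwiseDisjoint T := by
    intro z hz z' hz' hne
    rw [Function.onFun, Finset.disjoint_left]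
    intro y hy hy'
    have := hcross z hz z' hz' hne y hy y hy'
    simp at this
    linarith
  have hXc : (Z.biUnion T).card = N := by
    rw [Finset.card_biUnion hdisj, Finset.sum_congr rfl hT1, hkN]
  let eq := (Z.biUnion T).equivFinOfCardEq hXc
  have hsum : ∀ φ : Ed d → ℝ, ∑ i, φ (eq.symm i : Ed d) = ∑ z ∈ Z, ∑ y ∈ T z, φ y := by
    intro φ
    rw [← Finset.sum_biUnion hdisj, ← Finset.sum_coe_sort (Z.biUnion T)]
    exact Equiv.sum_comp eq.symm (fun y => φ (y : Ed d))
  refine ⟨fun i => (eq.symm i : Ed d), ?_, ?_, ?_⟩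
  · intro i
    obtain ⟨z, hz, hy⟩ := Finset.mem_biUnion.1 (eq.symm i).2
    exact (hT2 z hz _ hy).1
  · intro i j hij
    rw [← hνd]
    obtain ⟨z, hz, hy⟩ := Finset.mem_biUnion.1 (eq.symm i).2
    obtain ⟨z', hz', hy'⟩ := Finset.mem_biUnion.1 (eq.symm j).2
    by_cases hzz : z = z'
    · subst hzz
      refine hT3 z hz _ hy _ hy' fun hcon => hij ?_
      exact eq.symm.injective (Subtype.ext hcon)
    · refine le_trans ?_ (hcross z hz z' hz' hzz _ hy _ hy')
      nlinarith
  · intro φ M L B hφ hM hM0 hB hL hnear hlip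
    have hsm : ∀ c : ℝ, c ≤ 2 * η → n * c ≤ 1 / 2 := by
      intro c hc
      have : n * c ≤ n * (2 * η) := by gcongr
      linarith
    have hSM := sum_M_le h Z hZ1 η hη (by linarith) hZsep M hM hM0 L
      (fun x z hx hz hxz => hnear x z hx hz (hsm _ (by linarith))) (by linarith)
    have hQ := weights_quad h Z hZ1 η w hw1 hw2 hw3 hw4 φ M hφ hM hM0 B hB
      (fun x z hx hz hxz => hlip x z hx hz (hsm _ (by linarith)))
    have hI0 : 0 ≤ ∫ x, M x ∂σ := integral_nonneg hM0
    set I := ∫ x, M x ∂σ with hI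
    set S := ∑ z ∈ Z, M z with hS
    have hS0 : 0 ≤ S := Finset.sum_nonneg fun z _ => hM0 z
    have hR := hround φ
    have hR2 : ∑ z ∈ Z, |φ z - φ (p z)| ≤ B * (2 * η) * S := by
      rw [hS, Finset.mul_sum]
      refine Finset.sum_le_sum fun z hz => ?_
      refine (hlip z (p z) (hZ1 z hz) (hZ1 _ (hp z hz).1) (hsm _ (hpd z hz))).trans ?_
      have := hM0 z
      gcongr
      exact hpd z hz
    have hP : |∑ z ∈ Z, ∑ y ∈ T z, φ y - ∑ z ∈ Z, k z * φ z| ≤ K1 * (N * η ^ d) * (B * η) * S := by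
      rw [← Finset.sum_sub_distrib, hS, Finset.mul_sum]
      refine (Finset.abs_sum_le_sum_abs _ _).trans (Finset.sum_le_sum fun z hz => ?_)
      have e1 : ∑ y ∈ T z, φ y - k z * φ z = ∑ y ∈ T z, (φ y - φ z) := by
        rw [Finset.sum_sub_distrib, Finset.sum_const, hT1 z hz, nsmul_eq_mul]
      rw [e1]
      have hMz := hM0 z
      calc |∑ y ∈ T z, (φ y - φ z)| ≤ ∑ y ∈ T z, |φ y - φ z| := Finset.abs_sum_le_sum_abs _ _
        _ ≤ (T z).card • (B * η * M z) := by
          refine Finset.sum_le_card_nsmul _ _ _ fun y hy => ?_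
          obtain ⟨h1, h2⟩ := hT2 z hz y hy
          rw [abs_sub_comm]
          rw [norm_sub_rev] at h2
          refine (hlip z y (hZ1 z hz) h1 (hsm _ (by linarith))).trans ?_
          gcongr
          linarith
        _ = k z * (B * η * M z) := by rw [hT1 z hz, nsmul_eq_mul]
        _ ≤ K1 * (N * η ^ d) * (B * η * M z) := by
          gcongr
          exact hk z hz
        _ = _ := by ring
    have e2 : ∑ z ∈ Z, ((k z : ℝ) - N * ∫ x, w z x ∂σ) * φ z =
        ∑ z ∈ Z, k z * φ z - N * ∑ z ∈ Z, (∫ x, w z x ∂σ) * φ z := by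
      rw [Finset.mul_sum, ← Finset.sum_sub_distrib]
      exact Finset.sum_congr rfl fun z _ => by ring
    rw [e2] at hR
    rw [hsum φ]
    generalize ∑ z ∈ Z, ∑ y ∈ T z, φ y = s1 at *
    generalize ∑ z ∈ Z, k z * φ z = s2 at *
    generalize ∑ z ∈ Z, (∫ x, w z x ∂σ) * φ z = s3 at *
    generalize ∫ x, φ x ∂σ = s4 at *
    have e3 : (N : ℝ)⁻¹ * s1 - s4 = (N : ℝ)⁻¹ * ((s1 - s2) + (s2 - N * s3)) + (s3 - s4) := by
      field_simp
      ring
    rw [e3]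
    have hNinv : (N : ℝ)⁻¹ ≤ η ^ d := by
      rw [inv_le_iff_one_le_mul₀ hNpos, mul_comm]; exact hNη
    have f1 : |(N : ℝ)⁻¹ * ((s1 - s2) + (s2 - N * s3))| ≤ (K1 + 2) * (B * η) * (η ^ d * S) := by
      rw [abs_mul, abs_of_pos (inv_pos.2 hNpos)]
      calc (N : ℝ)⁻¹ * |(s1 - s2) + (s2 - N * s3)|
          ≤ (N : ℝ)⁻¹ * (K1 * (N * η ^ d) * (B * η) * S + B * (2 * η) * S) := by
            gcongr
            exact (abs_add_le _ _).trans (add_le_add hP (hR.trans hR2))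
        _ = K1 * (B * η) * (η ^ d * S) + 2 * (B * η) * ((N : ℝ)⁻¹ * S) := by
            field_simp
        _ ≤ K1 * (B * η) * (η ^ d * S) + 2 * (B * η) * (η ^ d * S) := by gcongr
        _ = _ := by ring
    have f2 : (K1 + 2) * (B * η) * (η ^ d * S) ≤ (K1 + 2) * (B * η) * (3 ^ d / a * L * I) := by
      gcongr
    have hηr : η ≤ r / n := by
      rw [hηd]
      gcongr
      linarith
    have f3 : B * η * I ≤ L * (B * η * I) := le_mul_of_one_le_left (by positivity) hL
    calc _ ≤ _ := abs_add_le _ _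
      _ ≤ (K1 + 2) * (B * η) * (3 ^ d / a * L * I) + L * (B * η * I) :=
          add_le_add (f1.trans f2) (hQ.trans f3)
      _ = (1 + (K1 + 2) * (3 ^ d / a)) * L * B * η * I := by ring
      _ ≤ _ := by gcongr

lemma nrm_sep {d : ℕ} {n s δ : ℝ} (hn : 1 ≤ n) (hs : 0 < s) (hsn : s * n = δ) (hδ : δ ≤ 1 / 20)
    (x x' v v' : Ed d) (hx : ‖x‖ = 1) (hx' : ‖x'‖ = 1) (hv : ‖v‖ ≤ 1) (hv' : ‖v'‖ ≤ 1)
    (hvv : ‖v - v'‖ ≤ n * ‖x - x'‖) :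
    1 / 2 * ‖x - x'‖ ≤ ‖nrm (x + s • v) - nrm (x' + s • v')‖ := by
  have hδ0 : 0 < δ := by rw [← hsn]; positivity
  have hsδ : s ≤ δ := by rw [← hsn]; nlinarith
  set D := ‖x - x'‖ with hD
  have hD0 : 0 ≤ D := norm_nonneg _
  have hsv : ∀ w : Ed d, ‖w‖ ≤ 1 → ‖s • w‖ ≤ δ := fun w hw => by
    rw [norm_smul, Real.norm_of_nonneg hs.le]; nlinarith [norm_nonneg w]
  have hub : ∀ y w : Ed d, ‖y‖ = 1 → ‖w‖ ≤ 1 → 1 - δ ≤ ‖y + s • w‖ ∧ ‖y + s • w‖ ≤ 1 + δ := by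
    intro y w hy hw
    have h1 := hsv w hw
    have h2 := norm_add_le y (s • w)
    have h3 := norm_sub_le (y + s • w) (s • w)
    rw [add_sub_cancel_right] at h3
    constructor <;> linarith
  obtain ⟨hu1, hu2⟩ := hub x v hx hv
  obtain ⟨hu1', hu2'⟩ := hub x' v' hx' hv'
  have hsq : ‖x + s • v‖ ^ 2 - ‖x' + s • v'‖ ^ 2 =
      2 * s * (inner ℝ (x - x') v + inner ℝ x' (v - v')) +
        s ^ 2 * ((‖v‖ - ‖v'‖) * (‖v‖ + ‖v'‖)) := by
    rw [norm_add_sq_real, norm_add_sq_real, hx, hx', norm_smul, norm_smul, inner_smul_right,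
      inner_smul_right, inner_sub_left, inner_sub_right, Real.norm_of_nonneg hs.le]
    ring
  have i1 : |inner ℝ (x - x') v| ≤ D := by
    refine (abs_real_inner_le_norm _ _).trans ?_
    nlinarith
  have i2 : |inner ℝ x' (v - v')| ≤ n * D := by
    refine (abs_real_inner_le_norm _ _).trans ?_
    rw [hx', one_mul]; exact hvv
  have i3 : |(‖v‖ - ‖v'‖) * (‖v‖ + ‖v'‖)| ≤ n * D * 2 := by
    rw [abs_mul]
    refine mul_le_mul ((abs_norm_sub_norm_le _ _).trans hvv) ?_ (abs_nonneg _) (by positivity)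
    rw [abs_of_nonneg (by positivity)]
    linarith
  have hsq2 : |‖x + s • v‖ ^ 2 - ‖x' + s • v'‖ ^ 2| ≤ 5 * δ * D := by
    rw [hsq]
    refine (abs_add_le _ _).trans ?_
    rw [abs_mul, abs_mul (s ^ 2), abs_of_pos (by positivity : 0 < 2 * s),
      abs_of_pos (by positivity : 0 < s ^ 2)]
    have j1 : 2 * s * |inner ℝ (x - x') v + inner ℝ x' (v - v')| ≤ 2 * s * (D + n * D) := by
      gcongr
      exact (abs_add_le _ _).trans (add_le_add i1 i2)
    have j2 : s ^ 2 * |(‖v‖ - ‖v'‖) * (‖v‖ + ‖v'‖)| ≤ s ^ 2 * (n * D * 2) := by gcongr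
    have j3 : s ^ 2 * (n * D * 2) = 2 * s * δ * D := by rw [← hsn]; ring
    have j4 : 2 * s * (D + n * D) = 2 * s * D + 2 * δ * D := by rw [← hsn]; ring
    have j5 : s * D ≤ δ * D := by gcongr
    have j6 : 2 * s * δ * D ≤ δ * D := by
      have : 0 ≤ δ * D := by positivity
      nlinarith
    linarith
  have hdiff : |‖x + s • v‖ - ‖x' + s • v'‖| ≤ 3 * δ * D := by
    have h1 : |‖x + s • v‖ ^ 2 - ‖x' + s • v'‖ ^ 2| =
        |‖x + s • v‖ - ‖x' + s • v'‖| * (‖x + s • v‖ + ‖x' + s • v'‖) := by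
      rw [sq_sub_sq, abs_mul, abs_of_nonneg (by positivity : 0 ≤ ‖x + s • v‖ + ‖x' + s • v'‖),
        mul_comm]
    rw [h1] at hsq2
    have h2 : |‖x + s • v‖ - ‖x' + s • v'‖| * (19 / 10) ≤ 5 * δ * D :=
      le_trans (by gcongr; linarith) hsq2
    have h3 : 0 ≤ δ * D := by positivity
    linarith
  have hlow : (1 - δ) * D ≤ ‖(x + s • v) - (x' + s • v')‖ := by
    have h1 : x - x' = ((x + s • v) - (x' + s • v')) - s • (v - v') := by
      rw [smul_sub]; abel
    have h2 : D ≤ ‖(x + s • v) - (x' + s • v')‖ + ‖s • (v - v')‖ := by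
      rw [hD]; nth_rewrite 1 [h1]; exact norm_sub_le _ _
    have h3 : ‖s • (v - v')‖ ≤ δ * D := by
      rw [norm_smul, Real.norm_of_nonneg hs.le, ← hsn, mul_assoc]
      gcongr
    linarith
  have hne : x + s • v ≠ 0 := norm_pos_iff.1 (by linarith)
  have hne' : x' + s • v' ≠ 0 := norm_pos_iff.1 (by linarith)
  have hrep : ∀ u : Ed d, u ≠ 0 → u = ‖u‖ • nrm u := fun u hu => by
    rw [nrm, smul_smul, mul_inv_cancel₀ (norm_ne_zero_iff.2 hu), one_smul]
  have hfin : ‖(x + s • v) - (x' + s • v')‖ ≤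
      ‖x + s • v‖ * ‖nrm (x + s • v) - nrm (x' + s • v')‖ + |‖x + s • v‖ - ‖x' + s • v'‖| := by
    have h1 : (x + s • v) - (x' + s • v') = ‖x + s • v‖ • (nrm (x + s • v) - nrm (x' + s • v')) +
        (‖x + s • v‖ - ‖x' + s • v'‖) • nrm (x' + s • v') := by
      rw [smul_sub, sub_smul, ← hrep _ hne, ← hrep _ hne']
      abel
    nth_rewrite 1 [h1]
    refine (norm_add_le _ _).trans ?_
    rw [norm_smul, norm_smul, nrm_norm hne', norm_norm, Real.norm_eq_abs, mul_one]
  have hf2 : ‖x + s • v‖ * ‖nrm (x + s • v) - nrm (x' + s • v')‖ ≤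
      21 / 20 * ‖nrm (x + s • v) - nrm (x' + s • v')‖ := by
    gcongr; linarith
  have h3 : δ * D ≤ 1 / 20 * D := by gcongr
  linarith

lemma deriv_nonneg_of_min {F : ℝ → ℝ} {D : ℝ} (hF : HasDerivAt F D 0)
    (hmin : ∀ ε, 0 ≤ ε → ε ≤ 1 → F 0 ≤ F ε) : 0 ≤ D := by
  have h1 := hF.tendsto_slope_zero_right
  refine ge_of_tendsto h1 ?_
  have h2 : ∀ᶠ t : ℝ in nhdsWithin 0 (Set.Ioi 0), t ∈ Set.Ioo (0 : ℝ) 1 :=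
    Ioo_mem_nhdsGT (by norm_num)
  filter_upwards [h2] with t ht
  have := hmin t ht.1.le ht.2.le
  rw [zero_add, smul_eq_mul]
  exact mul_nonneg (inv_nonneg.2 ht.1.le) (by linarith)

lemma u_curve {d : ℕ} (P : MvPolynomial (Fin (d + 1)) ℝ) (z w : Ed d) (hz : z ≠ 0) :
    HasDerivAt (fun ε : ℝ => ev P (nrm (z + ε • w))) (inner ℝ (gu P z) w) 0 := by
  have h1 : HasDerivAt (fun ε : ℝ => z + ε • w) w 0 := by
    simpa using ((hasDerivAt_id (0 : ℝ)).smul_const w).const_add z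
  have h2 : HasFDerivAt (fun z => ev P (nrm z)) (innerSL ℝ (gu P z)) (z + (0 : ℝ) • w) := by
    simpa using u_hasFDerivAt P z hz
  exact h2.comp_hasDerivAt (0 : ℝ) h1

/-- Existence of a critical configuration in a compact convex set. -/
lemma variational {d : ℕ} {σ : Measure (Ed d)} {a A : ℝ} (h : Reg d σ a A) (t N : ℕ) (hN : 0 < N)
    (x : Fin N → Ed d) (hx : ∀ i, ‖x i‖ = 1) (n s : ℝ) (hn : 0 ≤ n) (hs : 0 < s) (hs1 : s ≤ 1 / 20) :
    ∃ v : Fin N → Ed d, ∃ P : MvPolynomial (Fin (d + 1)) ℝ,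
      (∀ i, ‖v i‖ ≤ 1) ∧ (∀ i j, ‖v i - v j‖ ≤ n * ‖x i - x j‖) ∧
      P.totalDegree ≤ t ∧ ∫ y, ev P y ∂σ = 0 ∧
      ((N : ℝ)⁻¹ * ∑ i, ev P (nrm (x i + s • v i)) ≤ 0 → ∀ p : MvPolynomial (Fin (d + 1)) ℝ,
        p.totalDegree ≤ t → (N : ℝ)⁻¹ * ∑ i, ev p (nrm (x i + s • v i)) = ∫ y, ev p y ∂σ) ∧
      ∀ w : Fin N → Ed d, (∀ i, ‖w i‖ ≤ 1) → (∀ i j, ‖w i - w j‖ ≤ n * ‖x i - x j‖) →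
        0 ≤ ∑ i, inner ℝ (gu P (x i + s • v i)) (w i - v i) := by
  classical
  have hprob := h.prob
  have hN0 : (0 : ℝ) < N := by exact_mod_cast hN
  obtain ⟨I, hI⟩ : ∃ I : Finset (Fin (d + 1) →₀ ℕ), ∀ α, α ∈ I ↔ α.degree ≤ t := by
    have hf : {α : Fin (d + 1) →₀ ℕ | α.degree ≤ t}.Finite := Finsupp.finite_of_degree_le t
    exact ⟨hf.toFinset, by simp⟩
  let e : (Fin (d + 1) →₀ ℕ) → MvPolynomial (Fin (d + 1)) ℝ := fun α =>
    MvPolynomial.monomial α 1 - MvPolynomial.C (∫ y, ev (MvPolynomial.monomial α 1) y ∂σ)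
  have hei : ∀ α y, ev (e α) y = ev (MvPolynomial.monomial α 1) y -
      ∫ y, ev (MvPolynomial.monomial α 1) y ∂σ := fun α y => by
    simp only [ev, e, map_sub, MvPolynomial.eval_C]
  have hevi : ∀ p : MvPolynomial (Fin (d + 1)) ℝ, Integrable (ev p) σ := fun p =>
    h.integrable (ev_continuous p).continuousOn
  have he0 : ∀ α, ∫ y, ev (e α) y ∂σ = 0 := by
    intro α
    simp only [hei]
    rw [integral_sub (hevi _) (integrable_const _)]
    simp
  have hed : ∀ α ∈ I, (e α).totalDegree ≤ t := by
    intro α hα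
    refine (MvPolynomial.totalDegree_sub _ _).trans (max_le ?_ (by simp))
    exact (MvPolynomial.totalDegree_monomial_le _ _).trans ((hI α).1 hα)
  let Kc : Set (Fin N → Ed d) := {v | (∀ i, ‖v i‖ ≤ 1) ∧ ∀ i j, ‖v i - v j‖ ≤ n * ‖x i - x j‖}
  have hne : ∀ y w : Ed d, ‖y‖ = 1 → ‖w‖ ≤ 1 → y + s • w ≠ 0 := by
    intro y w hy hw hcon
    have h1 : y = -(s • w) := eq_neg_of_add_eq_zero_left hcon
    have h2 : ‖y‖ ≤ s * 1 := by
      rw [h1, norm_neg, norm_smul, Real.norm_of_nonneg hs.le]; gcongr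
    linarith
  have hKcomp : IsCompact Kc := by
    have h1 : IsCompact (Set.pi Set.univ fun _ : Fin N => Metric.closedBall (0 : Ed d) 1) :=
      isCompact_univ_pi fun _ => isCompact_closedBall _ _
    refine h1.of_isClosed_subset ?_ ?_
    · have : Kc = (⋂ i, {v : Fin N → Ed d | ‖v i‖ ≤ 1}) ∩
          ⋂ i, ⋂ j, {v : Fin N → Ed d | ‖v i - v j‖ ≤ n * ‖x i - x j‖} := by
        ext v; simp [Kc]
      rw [this]
      refine (isClosed_iInter fun i => ?_).inter (isClosed_iInter fun i => isClosed_iInter fun j => ?_)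
      · exact isClosed_le (by fun_prop) (by fun_prop)
      · exact isClosed_le (by fun_prop) (by fun_prop)
    · intro v hv
      simp only [Set.mem_pi, Set.mem_univ, true_imp_iff, mem_closedBall_zero_iff]
      exact hv.1
  let c : (Fin N → Ed d) → (Fin (d + 1) →₀ ℕ) → ℝ := fun v α =>
    (N : ℝ)⁻¹ * ∑ i, ev (e α) (nrm (x i + s • v i))
  have hcc : ContinuousOn (fun v => ∑ α ∈ I, c v α ^ 2) Kc := by
    refine continuousOn_finsetSum _ fun α _ => (ContinuousOn.pow ?_ 2)
    refine continuousOn_const.mul (continuousOn_finsetSum _ fun i _ => ?_)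
    refine (ev_continuous _).comp_continuousOn ?_
    unfold nrm
    have h1 : Continuous fun v : Fin N → Ed d => x i + s • v i := by fun_prop
    refine ContinuousOn.smul (ContinuousOn.inv₀ h1.norm.continuousOn fun v hv => ?_) h1.continuousOn
    exact norm_ne_zero_iff.2 (hne _ _ (hx i) (hv.1 i))
  obtain ⟨v, hvK, hvmin⟩ := hKcomp.exists_isMinOn ⟨0, by simp [Kc]; intros; positivity⟩ hcc
  have hevP : ∀ y, ev (∑ α ∈ I, c v α • e α) y = ∑ α ∈ I, c v α * ev (e α) y := fun y => by
    simp only [ev, map_sum, MvPolynomial.smul_eval]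
  have hsumP : ∀ u : Fin N → Ed d,
      (N : ℝ)⁻¹ * ∑ i, ev (∑ α ∈ I, c v α • e α) (nrm (x i + s • u i)) =
      ∑ α ∈ I, c v α * c u α := by
    intro u
    simp only [hevP, c]
    rw [Finset.sum_comm, Finset.mul_sum]
    refine Finset.sum_congr rfl fun α _ => ?_
    rw [← Finset.mul_sum]; ring
  refine ⟨v, ∑ α ∈ I, c v α • e α, hvK.1, hvK.2, ?_, ?_, ?_, ?_⟩
  · refine MvPolynomial.totalDegree_finsetSum_le fun α hα => ?_
    exact (MvPolynomial.totalDegree_smul_le _ _).trans (hed α hα)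
  · simp only [hevP]
    rw [integral_finsetSum _ fun α _ => (hevi _).const_mul _]
    refine Finset.sum_eq_zero fun α _ => ?_
    rw [integral_const_mul, he0, mul_zero]
  · intro hle p hp
    rw [hsumP] at hle
    have hc0 : ∀ α ∈ I, c v α = 0 := by
      have h1 : ∑ α ∈ I, c v α * c v α = 0 :=
        le_antisymm hle (Finset.sum_nonneg fun α _ => mul_self_nonneg _)
      intro α hα
      have := (Finset.sum_eq_zero_iff_of_nonneg fun α _ => mul_self_nonneg _).1 h1 α hα
      simpa using this
    have hmono : ∀ α ∈ I, (N : ℝ)⁻¹ * ∑ i, ev (MvPolynomial.monomial α 1) (nrm (x i + s • v i)) =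
        ∫ y, ev (MvPolynomial.monomial α 1) y ∂σ := by
      intro α hα
      have h1 := hc0 α hα
      simp only [c, hei, Finset.sum_sub_distrib, Finset.sum_const, Finset.card_univ,
        Fintype.card_fin, nsmul_eq_mul, mul_sub] at h1
      rw [inv_mul_cancel_left₀ hN0.ne'] at h1
      linarith
    have hp' : ∀ y : Ed d, ev p y = ∑ α ∈ p.support,
        p.coeff α * ev (MvPolynomial.monomial α 1) y := by
      intro y
      simp only [ev]
      conv_lhs => rw [p.as_sum, map_sum]
      refine Finset.sum_congr rfl fun α _ => ?_
      simp [MvPolynomial.eval_monomial]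
    simp only [hp']
    rw [integral_finsetSum _ fun α _ => (hevi _).const_mul _, Finset.sum_comm, Finset.mul_sum]
    refine Finset.sum_congr rfl fun α hα => ?_
    rw [integral_const_mul, ← hmono α ((hI α).2 ((MvPolynomial.le_totalDegree hα).trans hp)),
      ← Finset.mul_sum]
    ring
  · intro w hw1 hw2
    have hcurve : ∀ Q : MvPolynomial (Fin (d + 1)) ℝ, HasDerivAt
        (fun ε : ℝ => (N : ℝ)⁻¹ * ∑ i, ev Q (nrm (x i + s • (v i + ε • (w i - v i)))))
        ((N : ℝ)⁻¹ * ∑ i, inner ℝ (gu Q (x i + s • v i)) (s • (w i - v i))) 0 := by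
      intro Q
      refine HasDerivAt.const_mul _ (HasDerivAt.fun_sum fun i _ => ?_)
      have h1 := u_curve Q (x i + s • v i) (s • (w i - v i)) (hne _ _ (hx i) (hvK.1 i))
      have h2 : ∀ ε : ℝ, x i + s • (v i + ε • (w i - v i)) =
          x i + s • v i + ε • s • (w i - v i) := fun ε => by
        rw [smul_add, smul_comm s ε, add_assoc]
      simp only [h2]
      exact h1
    let u : ℝ → Fin N → Ed d := fun ε i => v i + ε • (w i - v i)
    have hu0 : u 0 = v := by ext1 i; simp [u]
    have huK : ∀ ε, 0 ≤ ε → ε ≤ 1 → u ε ∈ Kc := by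
      intro ε h0 h1
      have hu : ∀ i, u ε i = (1 - ε) • v i + ε • w i := fun i => by
        simp only [u, smul_sub, sub_smul, one_smul]; abel
      constructor
      · intro i
        rw [hu]
        refine (norm_add_le _ _).trans ?_
        rw [norm_smul, norm_smul, Real.norm_of_nonneg h0, Real.norm_of_nonneg (by linarith)]
        nlinarith [hvK.1 i, hw1 i]
      · intro i j
        rw [hu, hu]
        have : (1 - ε) • v i + ε • w i - ((1 - ε) • v j + ε • w j) =
          (1 - ε) • (v i - v j) + ε • (w i - w j) := by simp only [smul_sub]; abel
        rw [this]
        refine (norm_add_le _ _).trans ?_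
        rw [norm_smul, norm_smul, Real.norm_of_nonneg h0, Real.norm_of_nonneg (by linarith)]
        nlinarith [hvK.2 i j, hw2 i j]
    have hcd : ∀ α, HasDerivAt (fun ε : ℝ => c (u ε) α)
        ((N : ℝ)⁻¹ * ∑ i, inner ℝ (gu (e α) (x i + s • v i)) (s • (w i - v i))) 0 :=
      fun α => hcurve (e α)
    have hF : HasDerivAt (fun ε : ℝ => ∑ α ∈ I, c (u ε) α ^ 2) (∑ α ∈ I, 2 * (c v α *
        ((N : ℝ)⁻¹ * ∑ i, inner ℝ (gu (e α) (x i + s • v i)) (s • (w i - v i))))) 0 := by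
      refine HasDerivAt.fun_sum fun α _ => ?_
      have := (hcd α).fun_pow 2
      rw [hu0] at this
      refine this.congr_deriv ?_
      simp; ring
    have hD := deriv_nonneg_of_min hF (fun ε h0 h1 => by
      rw [hu0]; exact hvmin (huK ε h0 h1))
    have hG1 : HasDerivAt (fun ε : ℝ => ∑ α ∈ I, c v α * c (u ε) α) (∑ α ∈ I, (c v α *
        ((N : ℝ)⁻¹ * ∑ i, inner ℝ (gu (e α) (x i + s • v i)) (s • (w i - v i))))) 0 :=
      HasDerivAt.fun_sum fun α _ => (hcd α).const_mul _
    have hG2 := hcurve (∑ α ∈ I, c v α • e α)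
    have hG3 : (fun ε : ℝ => (N : ℝ)⁻¹ * ∑ i, ev (∑ α ∈ I, c v α • e α)
        (nrm (x i + s • (v i + ε • (w i - v i))))) = fun ε => ∑ α ∈ I, c v α * c (u ε) α := by
      ext ε
      exact hsumP (u ε)
    rw [hG3] at hG2
    rw [← Finset.mul_sum, hG1.unique hG2] at hD
    simp only [inner_smul_right, ← Finset.mul_sum] at hD
    have h1 : 0 < 2 * ((N : ℝ)⁻¹ * s) := by positivity
    refine nonneg_of_mul_nonneg_right (b := _) (a := 2 * ((N : ℝ)⁻¹ * s)) ?_ h1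
    calc (0 : ℝ) ≤ _ := hD
      _ = _ := by ring

lemma final_arith (C δ q I n s SP SH SM H : ℝ) (hC : 1 ≤ C) (hδ : 0 < δ) (hδC : δ * (1000 * C ^ 5) = 1)
    (hq : 0 ≤ q) (hqδ : q * (100 * C ^ 7) ≤ δ) (hI : 0 ≤ I) (hn : 0 < n) (hs : s * n = δ)
    (h1 : SP ≤ 4 * C ^ 2 * (q / n) * I) (h2 : H - 3 * C ^ 5 * q * I ≤ SH) (h3 : I ≤ C ^ 2 * H)
    (h4 : SM ≤ I + C ^ 2 * q * I) :
    SP - s * (4 * C ^ 2)⁻¹ * SH + 18 * C * n * s ^ 2 * SM ≤ 0 := by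
  have hC0 : 0 < C := by linarith
  have hs' : s = δ / n := by rw [← hs]; field_simp
  have hs0 : 0 < s := by rw [hs']; positivity
  have hp : ∀ k : ℕ, 1 ≤ C ^ k := fun k => one_le_pow₀ hC
  have hδ1 : δ ≤ 1 / 1000 := by nlinarith [hp 5]
  -- small parameter bounds
  have q7 : q * C ^ 7 ≤ δ / 100 := by linarith
  have q6 : q * C ^ 6 ≤ δ / 100 := by
    refine le_trans ?_ q7
    exact mul_le_mul_of_nonneg_left (pow_le_pow_right₀ hC (by norm_num)) hq
  have q2 : q * C ^ 2 ≤ δ / 100 := by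
    refine le_trans ?_ q7
    exact mul_le_mul_of_nonneg_left (pow_le_pow_right₀ hC (by norm_num)) hq
  have key : n * C ^ 4 * (SP - s * (4 * C ^ 2)⁻¹ * SH + 18 * C * n * s ^ 2 * SM) ≤ 0 := by
    have e : n * C ^ 4 * (SP - s * (4 * C ^ 2)⁻¹ * SH + 18 * C * n * s ^ 2 * SM) =
        C ^ 4 * (n * SP) - δ / 4 * (C ^ 2 * SH) + 18 * (δ * C ^ 5) * δ * SM := by
      rw [hs']; field_simp
    rw [e]
    have a1 : C ^ 4 * (n * SP) ≤ 4 * (δ / 100) * I := by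
      have : n * SP ≤ 4 * C ^ 2 * q * I := by
        calc n * SP ≤ n * (4 * C ^ 2 * (q / n) * I) := by gcongr
          _ = _ := by field_simp
      calc C ^ 4 * (n * SP) ≤ C ^ 4 * (4 * C ^ 2 * q * I) := by gcongr
        _ = 4 * (q * C ^ 6) * I := by ring
        _ ≤ _ := by gcongr
    have a2 : I * (1 - 3 / 100 * δ) ≤ C ^ 2 * SH := by
      have : C ^ 2 * (H - 3 * C ^ 5 * q * I) ≤ C ^ 2 * SH := by gcongr
      have : q * C ^ 7 * I ≤ δ / 100 * I := by gcongr
      nlinarith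
    have a3 : SM ≤ 2 * I := by
      have : q * C ^ 2 * I ≤ δ / 100 * I := by gcongr
      nlinarith
    have a4 : δ * C ^ 5 = 1 / 1000 := by linarith
    rw [a4]
    have a5 : 18 * (1 / 1000) * δ * SM ≤ 18 * (1 / 1000) * δ * (2 * I) := by gcongr
    have a6 : δ / 4 * (I * (1 - 3 / 100 * δ)) ≤ δ / 4 * (C ^ 2 * SH) := by gcongr
    have a7 : 0 ≤ δ * I := by positivity
    have a8 : δ * (δ * I) ≤ 1 / 1000 * (δ * I) := by gcongr
    nlinarith
  by_contra hh
  push Not at hh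
  have : 0 < n * C ^ 4 * (SP - s * (4 * C ^ 2)⁻¹ * SH + 18 * C * n * s ^ 2 * SM) := by positivity
  linarith

lemma pointwise_bound {d : ℕ} {σ : Measure (Ed d)} {n : ℕ} (hn : 0 < n) {C : ℝ} (hC : 1 ≤ C)
    {P : MvPolynomial (Fin (d + 1)) ℝ} {M : Ed d → ℝ} (hM : GoodM d σ n C (gr P) M)
    (x v w : Ed d) (hx : ‖x‖ = 1) (hv : ‖v‖ ≤ 1) (hw : ‖w‖ ≤ 1) (s : ℝ) (hs : 0 < s)
    (hsn : s * n ≤ 1 / 2) (hwd : w = -(4 * C ^ 2)⁻¹ • qd (gr P) M x) :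
    ev P (nrm (x + s • v)) ≤ ev P x - s * (4 * C ^ 2)⁻¹ * hd (gr P) M x
      - s * inner ℝ (gu P (x + s • v)) (w - v) + 18 * C * n * s ^ 2 * M x := by
  have hM0 := hM.nonneg x
  have hn0 : (0 : ℝ) < n := by exact_mod_cast hn
  have e1 : x + s • v - x = s • v := by abel
  have e2 : ‖s • v‖ ≤ s := by
    rw [norm_smul, Real.norm_of_nonneg hs.le]; nlinarith [norm_nonneg v]
  have hz : (n : ℝ) * ‖x + s • v - x‖ ≤ 1 / 2 := by
    rw [e1]; nlinarith
  have t1 := u_taylor hn (by linarith) hM x (x + s • v) hx hz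
  have t2 := gu_near hn (by linarith) hM x (x + s • v) hx hz
  rw [e1] at t1 t2
  have t1' := (abs_le.1 t1).2
  have t3 : 6 * C * n * ‖s • v‖ ^ 2 * M x ≤ 6 * C * n * s ^ 2 * M x := by gcongr
  have t4 : 6 * C * n * ‖s • v‖ * M x ≤ 6 * C * n * s * M x := by gcongr
  have t5 : |inner ℝ (gu P (x + s • v) - gr P x) (w - v)| ≤ 6 * C * n * s * M x * 2 := by
    refine (abs_real_inner_le_norm _ _).trans ?_
    have : ‖w - v‖ ≤ 2 := (norm_sub_le _ _).trans (by linarith)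
    exact mul_le_mul (t2.trans t4) this (norm_nonneg _) (by positivity)
  have t6 := (abs_le.1 t5).2
  rw [inner_sub_left] at t6
  have t7 : inner ℝ (gr P x) w = -((4 * C ^ 2)⁻¹ * hd (gr P) M x) := by
    rw [hwd, inner_smul_right, hd]; ring
  have t8 : inner ℝ (gr P x) (w - v) = inner ℝ (gr P x) w - inner ℝ (gr P x) v := inner_sub_right _ _ _
  have t9 : inner ℝ (gr P x) (s • v) = s * inner ℝ (gr P x) v := inner_smul_right _ _ _
  rw [t9] at t1'
  have t10 : inner ℝ (gr P x) v ≤ -((4 * C ^ 2)⁻¹ * hd (gr P) M x) 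
      - inner ℝ (gu P (x + s • v)) (w - v) + 12 * C * n * s * M x := by linarith
  have t11 := mul_le_mul_of_nonneg_left t10 hs.le
  nlinarith

theorem main_reg {d : ℕ} (hd1 : 1 ≤ d) {σ : Measure (Ed d)} {a A : ℝ} (h : Reg d σ a A) :
    ∃ C β : ℝ, 0 < C ∧ 0 < β ∧ ∀ t N : ℕ, 0 < t → C * (t : ℝ) ^ d ≤ (N : ℝ) →
      ∃ y : Fin N → Ed d, (∀ i, ‖y i‖ = 1) ∧
        (∀ i j, i ≠ j → β * (N : ℝ) ^ (-(1 : ℝ) / d) ≤ ‖y i - y j‖) ∧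
        ∀ p : MvPolynomial (Fin (d + 1)) ℝ, p.totalDegree ≤ t →
          (N : ℝ)⁻¹ * ∑ i, ev p (y i) = ∫ y, ev p y ∂σ := by
  have hprob := h.prob
  obtain ⟨C, hC, hgood⟩ := exists_goodM h
  obtain ⟨K, hK, hdisc⟩ := discretize hd1 h
  have hC0 : 0 < C := by linarith
  obtain ⟨δ, hδd⟩ : ∃ δ, δ = 1 / (1000 * C ^ 5) := ⟨_, rfl⟩
  have hδ : 0 < δ := by rw [hδd]; positivity
  have hδC : δ * (1000 * C ^ 5) = 1 := by rw [hδd]; field_simp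
  have hδ1 : δ ≤ 1 / 1000 := by nlinarith [one_le_pow₀ (n := 5) hC]
  obtain ⟨r, hrd⟩ : ∃ r, r = min 1 (δ / (100 * K * C ^ 7)) := ⟨_, rfl⟩
  have hr : 0 < r := by rw [hrd]; positivity
  have hr1 : r ≤ 1 := by rw [hrd]; exact min_le_left _ _
  have hqδ : K * r * (100 * C ^ 7) ≤ δ := by
    have : r ≤ δ / (100 * K * C ^ 7) := by rw [hrd]; exact min_le_right _ _
    rw [le_div_iff₀ (by positivity)] at this
    linarith
  obtain ⟨Cr, β, hCr, hβ, hmain⟩ := hdisc r hr hr1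
  refine ⟨Cr * 3 ^ d, β / 2, by positivity, by positivity, fun t N ht hN => ?_⟩
  obtain ⟨n, hnd⟩ : ∃ n, n = t + 2 := ⟨_, rfl⟩
  have hn : 0 < n := by omega
  have hn1 : (1 : ℝ) ≤ n := by exact_mod_cast hn
  have hn0 : (0 : ℝ) < n := by linarith
  have hnN : Cr * (n : ℝ) ^ d ≤ N := by
    refine le_trans ?_ hN
    rw [mul_assoc, ← mul_pow]
    have : (n : ℝ) ≤ 3 * t := by
      have : n ≤ 3 * t := by omega
      exact_mod_cast this
    gcongr
  have hNpos : 0 < N := by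
    have : (0 : ℝ) < N := lt_of_lt_of_le (by positivity) hnN
    exact_mod_cast this
  have hN0 : (0 : ℝ) < N := by exact_mod_cast hNpos
  obtain ⟨x, hx, hsep, hx3⟩ := hmain n N hn hnN
  obtain ⟨s, hsd⟩ : ∃ s, s = δ / n := ⟨_, rfl⟩
  have hs : 0 < s := by rw [hsd]; positivity
  have hsn : s * n = δ := by rw [hsd]; field_simp
  have hs1 : s ≤ 1 / 20 := by nlinarith
  obtain ⟨v, P, hv, hvv, hPt, hP0, hPfin, hPw⟩ := variational h t N hNpos x hx n s hn0.le hs hs1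
  obtain ⟨M, hM⟩ := hgood n P (by omega)
  have hne : ∀ i, x i + s • v i ≠ 0 := fun i hi => by
    have h1 : x i = -(s • v i) := eq_neg_of_add_eq_zero_left hi
    have h2 := hx i
    rw [h1, norm_neg, norm_smul, Real.norm_of_nonneg hs.le] at h2
    nlinarith [hv i, norm_nonneg (v i)]
  refine ⟨fun i => nrm (x i + s • v i), fun i => nrm_norm (hne i), fun i j hij => ?_, hPfin ?_⟩
  · have h1 := nrm_sep hn1 hs hsn (by linarith) (x i) (x j) (v i) (v j) (hx i) (hx j) (hv i) (hv j)
      (hvv i j)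
    have h2 := hsep i j hij
    linarith
  obtain ⟨w, hwd⟩ : ∃ w : Fin N → Ed d, ∀ i, w i = -(4 * C ^ 2)⁻¹ • qd (gr P) M (x i) :=
    ⟨_, fun _ => rfl⟩
  have hC2 : 1 ≤ C ^ 2 := one_le_pow₀ hC
  have hCC : C ≤ C ^ 2 := by nlinarith
  have hw4 : ∀ i, ‖w i‖ ≤ 1 / 4 := fun i => by
    rw [hwd, norm_smul, norm_neg, norm_inv, Real.norm_of_nonneg (by positivity), inv_mul_le_iff₀ (by positivity)]
    have := qd_le hC0.le hM (x i) (hx i)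
    linarith
  have hww : ∀ i j, ‖w i - w j‖ ≤ n * ‖x i - x j‖ := fun i j => by
    by_cases hc : n * ‖x i - x j‖ ≤ 1
    · rw [hwd, hwd, ← smul_sub, norm_smul, norm_neg, norm_inv, Real.norm_of_nonneg (by positivity),
        inv_mul_le_iff₀ (by positivity)]
      have := qd_lip hC hM (x i) (x j) (hx i) (hx j) hc
      have h2 : 0 ≤ C ^ 2 * (n * ‖x i - x j‖) := by positivity
      linarith
    · have := norm_sub_le (w i) (w j)
      linarith [hw4 i, hw4 j]
  have hPw' := hPw w (fun i => (hw4 i).trans (by norm_num)) hww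
  have hI : 0 ≤ ∫ y, M y ∂σ := integral_nonneg hM.nonneg
  have hnear : ∀ x y : Ed d, ‖x‖ = 1 → ‖y‖ = 1 → n * ‖x - y‖ ≤ 1 / 2 → M y ≤ C * M x :=
    fun x y _ _ hxy => hM.near x y (by linarith)
  have dP := hx3 (ev P) M C (4 * C) (ev_continuous P) hM.cont hM.nonneg (by positivity) hC hnear
    (fun x y hx hy hxy => P_lip hn hC0.le hM x y hx hy hxy)
  have dH := hx3 (hd (gr P) M) M C (3 * C ^ 4 * n) (hd_continuous (gr_continuous P) hM) hM.cont
    hM.nonneg (by positivity) hC hnear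
    (fun x y hx hy hxy => hd_lip hC hM x y hx hy (by linarith))
  have dM := hx3 M M C (C * n) hM.cont hM.cont
    hM.nonneg (by positivity) hC hnear
    (fun x y hx hy hxy => (hM.lip x y (by linarith)).trans (le_of_eq (by ring)))
  have hHI := hd_integral h hC (gr_continuous P) hM
  rw [hP0] at dP
  have dP' := (abs_le.1 dP).2
  have dH' := (abs_le.1 dH).1
  have dM' := (abs_le.1 dM).2
  have fa := final_arith C δ (K * r) (∫ y, M y ∂σ) n s ((N : ℝ)⁻¹ * ∑ i, ev P (x i))
    ((N : ℝ)⁻¹ * ∑ i, hd (gr P) M (x i)) ((N : ℝ)⁻¹ * ∑ i, M (x i)) (∫ y, hd (gr P) M y ∂σ)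
    hC hδ hδC (by positivity) hqδ hI hn0 hsn
    (by
      have : K * C * (4 * C) * (r / n) = 4 * C ^ 2 * (K * r / n) := by ring
      rw [this] at dP'; linarith)
    (by
      have : K * C * (3 * C ^ 4 * n) * (r / n) = 3 * C ^ 5 * (K * r) := by field_simp
      rw [this] at dH'; linarith)
    hHI
    (by
      have : K * C * (C * n) * (r / n) = C ^ 2 * (K * r) := by field_simp
      rw [this] at dM'; linarith)
  refine le_trans ?_ fa
  have hsum : ∑ i, ev P (nrm (x i + s • v i)) ≤ ∑ i, ev P (x i)
      - s * (4 * C ^ 2)⁻¹ * ∑ i, hd (gr P) M (x i) + 18 * C * n * s ^ 2 * ∑ i, M (x i) := by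
    have h1 := Finset.sum_le_sum (s := Finset.univ) fun i _ =>
      pointwise_bound hn hC hM (x i) (v i) (w i) (hx i) (hv i)
        ((hw4 i).trans (by norm_num)) s hs (by rw [hsn]; linarith) (hwd i)
    simp only [Finset.sum_add_distrib, Finset.sum_sub_distrib, ← Finset.mul_sum] at h1
    have := mul_nonneg hs.le hPw'
    linarith
  have := mul_le_mul_of_nonneg_left hsum (inv_nonneg.2 hN0.le)
  refine this.trans (le_of_eq (by ring))

lemma sq_le_imp {u v : ℝ} (h : u ^ 2 ≤ v ^ 2) (hv : 0 ≤ v) : u ≤ v :=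
  (le_abs_self u).trans (abs_le_of_sq_le_sq h hv)

lemma exists_proj {d : ℕ} (x : Ed d) (hx : ‖x‖ = 1) :
    ∃ π : Ed d →ₗ[ℝ] EuclideanSpace ℝ (Fin d),
      (∀ y, ‖y‖ ^ 2 = ‖π y‖ ^ 2 + (inner ℝ x y) ^ 2) ∧
      ∀ u, ∃ y, π y = u ∧ inner ℝ x y = 0 := by
  have hx0 : x ≠ 0 := by
    intro h; simp [h] at hx
  have : Fact (Module.finrank ℝ (Ed d) = d + 1) := ⟨by simp⟩
  let e := (OrthonormalBasis.fromOrthogonalSpanSingleton (𝕜 := ℝ) d hx0).repr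
  refine ⟨e.toLinearEquiv.toLinearMap ∘ₗ
    ((Submodule.span ℝ {x})ᗮ.orthogonalProjectionOnto).toLinearMap, fun y => ?_, fun u => ?_⟩
  · rw [Submodule.norm_sq_eq_add_norm_sq_projection y (Submodule.span ℝ {x}), add_comm]
    congr 1
    · simp
    · have : ‖(Submodule.span ℝ {x}).orthogonalProjectionOnto y‖ =
          ‖(Submodule.span ℝ {x}).starProjection y‖ := by
        rw [Submodule.starProjection_apply, Submodule.norm_coe]
      rw [this, Submodule.starProjection_unit_singleton ℝ hx, norm_smul, hx, mul_one]
      simp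
  · refine ⟨(e.symm u : (Submodule.span ℝ {x})ᗮ), ?_, ?_⟩
    · simp
    · exact Submodule.mem_orthogonal_singleton_iff_inner_right.1 (e.symm u).2

/-- Part of the closed ball lying on the sphere. -/
def cap {d : ℕ} (x : Ed d) (ρ : ℝ) : Set (Ed d) := Metric.closedBall x ρ ∩ Metric.sphere 0 1

lemma cap_lower {d : ℕ} (x : Ed d) (hx : ‖x‖ = 1) (ρ : ℝ) (hρ : 0 < ρ) (hρ1 : ρ ≤ 1) :
    μH[(d : ℝ)] (Metric.closedBall (0 : EuclideanSpace ℝ (Fin d)) (ρ / 2)) ≤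
      μH[(d : ℝ)] (cap x ρ) := by
  obtain ⟨π, h1, h2⟩ := exists_proj x hx
  have hL : LipschitzWith 1 π := by
    refine LipschitzWith.of_dist_le_mul fun a b => ?_
    rw [dist_eq_norm, dist_eq_norm, ← map_sub, NNReal.coe_one, one_mul]
    refine sq_le_imp ?_ (norm_nonneg _)
    rw [h1 (a - b)]; nlinarith [sq_nonneg (inner ℝ x (a - b))]
  have := hL.hausdorffMeasure_image_le (d := d) (by positivity) (cap x ρ)
  simp only [ENNReal.coe_one, ENNReal.one_rpow, one_mul] at this
  refine le_trans (measure_mono ?_) this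
  intro u hu
  have hu' : ‖u‖ ≤ ρ / 2 := by simpa using hu
  obtain ⟨y0, hy, hy2⟩ := h2 u
  have hxx : inner ℝ x x = (1 : ℝ) := by rw [real_inner_self_eq_norm_sq, hx]; norm_num
  have hπx : π x = 0 := by
    have := h1 x
    rw [hxx, hx] at this
    have : ‖π x‖ ^ 2 = 0 := by linarith
    simpa using this
  have hu2 : ‖u‖ ^ 2 ≤ ρ ^ 2 / 4 := by nlinarith [norm_nonneg u]
  have hρ2 : ρ ^ 2 ≤ 1 := by nlinarith
  have hb := Real.sq_sqrt (show 0 ≤ 1 - ‖u‖ ^ 2 by linarith)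
  have hb0 := Real.sqrt_nonneg (1 - ‖u‖ ^ 2)
  set b := Real.sqrt (1 - ‖u‖ ^ 2)
  refine ⟨y0 + b • x, ⟨?_, ?_⟩, ?_⟩
  · rw [Metric.mem_closedBall, dist_eq_norm]
    refine sq_le_imp ?_ hρ.le
    rw [h1]
    simp only [map_sub, map_add, map_smul, hy, hπx, inner_sub_right, inner_add_right, hy2,
      inner_smul_right, hxx, smul_zero, add_zero, sub_zero, zero_add, mul_one]
    have : b ≤ 1 := by nlinarith [sq_nonneg ‖u‖]
    nlinarith
  · rw [mem_sphere_zero_iff_norm]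
    have : ‖y0 + b • x‖ ^ 2 = 1 := by
      rw [h1]
      simp only [map_sub, map_add, map_smul, hy, hπx, inner_sub_right, inner_add_right, hy2,
        inner_smul_right, hxx, smul_zero, add_zero, sub_zero, zero_add, mul_one]
      linarith
    exact (pow_eq_one_iff_of_nonneg (norm_nonneg _) (by norm_num)).1 this
  · simp [hy, hπx]

lemma cap_upper {d : ℕ} (x : Ed d) (hx : ‖x‖ = 1) (ρ : ℝ) (hρ1 : ρ ≤ 1) :
    μH[(d : ℝ)] (cap x ρ) ≤
      3 ^ d * μH[(d : ℝ)] (Metric.closedBall (0 : EuclideanSpace ℝ (Fin d)) ρ) := by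
  obtain ⟨π, h1, h2⟩ := exists_proj x hx
  have hxx : inner ℝ x x = (1 : ℝ) := by rw [real_inner_self_eq_norm_sq, hx]; norm_num
  have hπx : π x = 0 := by
    have := h1 x
    rw [hxx, hx] at this
    have : ‖π x‖ ^ 2 = 0 := by linarith
    simpa using this
  have hcap : ∀ y ∈ cap x ρ, ‖y‖ = 1 ∧ 1 / 2 ≤ inner ℝ x y ∧ ‖π y‖ ≤ ρ ∧ ‖π y‖ ≤ 1 := by
    rintro y ⟨hy1, hy2⟩
    rw [Metric.mem_closedBall, dist_eq_norm] at hy1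
    rw [mem_sphere_zero_iff_norm] at hy2
    have e := @norm_sub_sq_real _ _ _ y x
    rw [hy2, hx, real_inner_comm] at e
    have e2 := h1 (y - x)
    rw [map_sub, hπx, sub_zero] at e2
    have h0 := norm_nonneg (y - x)
    have h3 : ‖π y‖ ≤ ‖y - x‖ := by
      refine sq_le_imp ?_ h0
      nlinarith [sq_nonneg (inner ℝ x (y - x))]
    refine ⟨hy2, by nlinarith, by linarith, by linarith⟩
  have hanti : ∀ y ∈ cap x ρ, ∀ z ∈ cap x ρ, ‖y - z‖ ≤ 3 * ‖π y - π z‖ := by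
    intro y hy z hz
    obtain ⟨a1, a2, a3, a4⟩ := hcap y hy
    obtain ⟨b1, b2, b3, b4⟩ := hcap z hz
    have e := h1 (y - z)
    rw [map_sub, inner_sub_right] at e
    have e1 := h1 y
    have e2 := h1 z
    rw [a1] at e1
    rw [b1] at e2
    have h5 : |‖π z‖ - ‖π y‖| ≤ ‖π y - π z‖ := by
      rw [norm_sub_rev]; exact abs_norm_sub_norm_le _ _
    have h6 : |inner ℝ x y - inner ℝ x z| ≤ 2 * ‖π y - π z‖ := by
      have e3 : (inner ℝ x y - inner ℝ x z) * (inner ℝ x y + inner ℝ x z) =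
        (‖π z‖ - ‖π y‖) * (‖π z‖ + ‖π y‖) := by linear_combination e2 - e1
      have e4 := congrArg abs e3
      rw [abs_mul, abs_mul, abs_of_nonneg (show 0 ≤ inner ℝ x y + inner ℝ x z by linarith),
        abs_of_nonneg (show 0 ≤ ‖π z‖ + ‖π y‖ by positivity)] at e4
      have e5 : |inner ℝ x y - inner ℝ x z| ≤ |inner ℝ x y - inner ℝ x z| *
        (inner ℝ x y + inner ℝ x z) := le_mul_of_one_le_right (abs_nonneg _) (by linarith)
      have e6 : |‖π z‖ - ‖π y‖| * (‖π z‖ + ‖π y‖) ≤ ‖π y - π z‖ * 2 :=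
        mul_le_mul h5 (by linarith) (by positivity) (norm_nonneg _)
      linarith
    refine sq_le_imp ?_ (by positivity)
    rw [e]
    have h7 : (inner ℝ x y - inner ℝ x z) ^ 2 ≤ (2 * ‖π y - π z‖) ^ 2 := by
      rw [← sq_abs]; gcongr
    nlinarith [sq_nonneg ‖π y - π z‖]
  let g := Function.invFunOn π (cap x ρ)
  have hg : ∀ y ∈ cap x ρ, g (π y) = y := by
    intro y hy
    have m1 := Function.invFunOn_mem (f := π) (s := cap x ρ) ⟨y, hy, rfl⟩
    have m2 := Function.invFunOn_eq (f := π) (s := cap x ρ) ⟨y, hy, rfl⟩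
    have := hanti _ m1 y hy
    rw [m2, sub_self, norm_zero, mul_zero] at this
    exact sub_eq_zero.1 (norm_le_zero_iff.1 this)
  have hgL : LipschitzOnWith 3 g (π '' cap x ρ) := by
    refine LipschitzOnWith.of_dist_le_mul ?_
    rintro _ ⟨y, hy, rfl⟩ _ ⟨z, hz, rfl⟩
    rw [hg y hy, hg z hz, dist_eq_norm, dist_eq_norm]
    exact hanti y hy z hz
  have := hgL.hausdorffMeasure_image_le (d := d) (by positivity)
  have himg : g '' (π '' cap x ρ) = cap x ρ := by
    ext y
    constructor
    · rintro ⟨_, ⟨y, hy, rfl⟩, rfl⟩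
      rwa [hg y hy]
    · intro hy
      exact ⟨π y, ⟨y, hy, rfl⟩, hg y hy⟩
  rw [himg] at this
  refine this.trans ?_
  rw [ENNReal.rpow_natCast]
  refine mul_le_mul' (by simp) (measure_mono ?_)
  rintro _ ⟨y, hy, rfl⟩
  simpa using (hcap y hy).2.2.1

lemma reg_sphereMeasure (d : ℕ) (hd : 1 ≤ d) : ∃ a A : ℝ, Reg d (sphereMeasure d) a A := by
  have hfin : Module.finrank ℝ (EuclideanSpace ℝ (Fin d)) = d := by simp
  have hH : (μH[(d : ℝ)] : Measure (EuclideanSpace ℝ (Fin d))).IsAddHaarMeasure := by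
    simpa using MeasureTheory.isAddHaarMeasure_hausdorffMeasure (E := EuclideanSpace ℝ (Fin d))
  obtain ⟨κ, hκ⟩ : ∃ κ, κ = (μH[(d : ℝ)] : Measure (EuclideanSpace ℝ (Fin d)))
    (Metric.closedBall 0 1) := ⟨_, rfl⟩
  have hball : ∀ r, 0 ≤ r → μH[(d : ℝ)] (Metric.closedBall (0 : EuclideanSpace ℝ (Fin d)) r) =
      ENNReal.ofReal (r ^ d) * κ := fun r hr => by
    rw [Measure.addHaar_closedBall' _ _ hr, hfin, hκ]
  have hκ0 : κ ≠ 0 := by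
    rw [hκ]; exact (Metric.measure_closedBall_pos _ _ one_pos).ne'
  have hκt : κ ≠ ⊤ := by
    rw [hκ]; exact (isCompact_closedBall _ _).measure_lt_top.ne
  obtain ⟨m, hm⟩ : ∃ m, m = μH[(d : ℝ)] (Metric.sphere (0 : Ed d) 1) := ⟨_, rfl⟩
  have hmt : m ≠ ⊤ := by
    rw [hm]
    refine ((isCompact_sphere (0 : Ed d) 1).measure_lt_top_of_nhdsWithin fun x hx => ?_).ne
    refine ⟨cap x 1, ?_, ?_⟩
    · rw [cap, Set.inter_comm]
      exact inter_mem_nhdsWithin _ (Metric.closedBall_mem_nhds _ one_pos)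
    · refine (cap_upper x (by simpa using hx) 1 le_rfl).trans_lt ?_
      rw [← hκ]
      exact ENNReal.mul_lt_top (by simp) hκt.lt_top
  have hm0 : m ≠ 0 := by
    let x : Ed d := EuclideanSpace.single 0 1
    have hx : ‖x‖ = 1 := by simp [x]
    have h1 := cap_lower x hx 1 one_pos le_rfl
    rw [hball _ (by norm_num)] at h1
    have h2 : μH[(d : ℝ)] (cap x 1) ≤ m := by
      rw [hm]; exact measure_mono Set.inter_subset_right
    have h3 : 0 < ENNReal.ofReal ((1 / 2) ^ d) * κ :=
      ENNReal.mul_pos (by simp) hκ0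
    exact (h3.trans_le (h1.trans h2)).ne'
  have hσ : ∀ x ρ, sphereMeasure d (Metric.closedBall x ρ) = m⁻¹ * μH[(d : ℝ)] (cap x ρ) := by
    intro x ρ
    rw [sphereMeasure, Measure.smul_apply, Measure.restrict_apply measurableSet_closedBall, ← hm]
    rfl
  have hσr : ∀ x ρ, (sphereMeasure d).real (Metric.closedBall x ρ) =
      m.toReal⁻¹ * (μH[(d : ℝ)] (cap x ρ)).toReal := by
    intro x ρ
    rw [measureReal_def, hσ, ENNReal.toReal_mul, ENNReal.toReal_inv]
  have hcapt : ∀ (x : Ed d) ρ, μH[(d : ℝ)] (cap x ρ) ≠ ⊤ := fun x ρ => by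
    refine ((measure_mono Set.inter_subset_right).trans_lt ?_).ne
    rw [← hm]; exact hmt.lt_top
  have hmr : 0 < m.toReal := ENNReal.toReal_pos hm0 hmt
  have hκr : 0 < κ.toReal := ENNReal.toReal_pos hκ0 hκt
  have hprob : IsProbabilityMeasure (sphereMeasure d) := ⟨by
    rw [sphereMeasure, Measure.smul_apply, Measure.restrict_apply MeasurableSet.univ, ← hm,
      Set.univ_inter, ← hm]
    exact ENNReal.inv_mul_cancel hm0 hmt⟩
  refine ⟨m.toReal⁻¹ * ((1 / 2) ^ d * κ.toReal), max 1 (m.toReal⁻¹ * (3 ^ d * κ.toReal)),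
    by positivity, by positivity, hprob, ?_, ?_, ?_⟩
  · rw [sphereMeasure]
    refine Measure.ae_smul_measure ?_ _
    filter_upwards [ae_restrict_mem (Metric.isClosed_sphere.measurableSet)] with x hx
    simpa using hx
  · intro x hx ρ hρ hρ1
    rw [hσr]
    have h1 := ENNReal.toReal_mono (hcapt x ρ) (cap_lower x hx ρ hρ hρ1)
    rw [hball _ (by positivity), ENNReal.toReal_mul, ENNReal.toReal_ofReal (by positivity)] at h1
    calc m.toReal⁻¹ * ((1 / 2) ^ d * κ.toReal) * ρ ^ d = m.toReal⁻¹ * ((ρ / 2) ^ d * κ.toReal) := by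
          rw [div_pow, div_pow]; ring
      _ ≤ _ := by gcongr
  · intro x hx ρ hρ
    by_cases hρ1 : ρ ≤ 1
    · rw [hσr]
      have h0 := cap_upper x hx ρ hρ1
      rw [hball _ hρ.le] at h0
      have h1 := ENNReal.toReal_mono (ENNReal.mul_ne_top (by simp)
        (ENNReal.mul_ne_top (by simp) hκt)) h0
      rw [ENNReal.toReal_mul, ENNReal.toReal_mul, ENNReal.toReal_ofReal (by positivity)] at h1
      simp only [ENNReal.toReal_pow, ENNReal.toReal_ofNat] at h1
      calc m.toReal⁻¹ * (μH[(d : ℝ)] (cap x ρ)).toReal ≤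
          m.toReal⁻¹ * (3 ^ d * (ρ ^ d * κ.toReal)) := by gcongr
        _ = m.toReal⁻¹ * (3 ^ d * κ.toReal) * ρ ^ d := by ring
        _ ≤ _ := by gcongr; exact le_max_right _ _
    · push Not at hρ1
      calc (sphereMeasure d).real (Metric.closedBall x ρ) ≤ 1 := measureReal_le_one
        _ = 1 * 1 := by norm_num
        _ ≤ _ := mul_le_mul (le_max_left _ _) (one_le_pow₀ hρ1.le) (by norm_num) (by positivity)

/-- Bondarenko–Radchenko–Viazovska, well-separated designs: for every `d ≥ 2`
there are positive constants `C_d`, `β_d` such that for every `t ≥ 1` and `N ≥ C_d t^d`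
there exists a spherical `t`-design with `N` points on `S^d` that is `β_d N^{-1/d}`-separated. -/
theorem exists_well_separated_spherical_design (d : ℕ) (hd : 2 ≤ d) :
    ∃ C β : ℝ, 0 < C ∧ 0 < β ∧ ∀ t N : ℕ, 0 < t → C * (t : ℝ) ^ d ≤ (N : ℝ) →
      ∃ X : Finset (EuclideanSpace ℝ (Fin (d + 1))),
        X.card = N ∧ (∀ x ∈ X, ‖x‖ = 1) ∧ IsSphericalDesign d t X ∧
          ∀ x ∈ X, ∀ y ∈ X, x ≠ y → β * (N : ℝ) ^ (-(1 : ℝ) / d) ≤ ‖x - y‖ := by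
  classical
  obtain ⟨a, A, h⟩ := reg_sphereMeasure d (by omega)
  obtain ⟨C, β, hC, hβ, hmain⟩ := main_reg (by omega) h
  refine ⟨C, β, hC, hβ, fun t N ht hN => ?_⟩
  obtain ⟨y, hy, hsep, hdes⟩ := hmain t N ht hN
  have hN0 : (0 : ℝ) < N := lt_of_lt_of_le (by positivity) hN
  have hinj : Function.Injective y := by
    intro i j hij
    by_contra hne
    have h1 := hsep i j hne
    rw [hij, sub_self, norm_zero] at h1
    have : 0 < β * (N : ℝ) ^ (-(1 : ℝ) / d) := by positivity
    linarith
  have hcard : (Finset.univ.image y).card = N := by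
    rw [Finset.card_image_of_injective _ hinj]; simp
  refine ⟨Finset.univ.image y, hcard, ?_, ?_, ?_⟩
  · intro x hx
    obtain ⟨i, -, rfl⟩ := Finset.mem_image.1 hx
    exact hy i
  · intro p hp
    rw [hcard, Finset.sum_image hinj.injOn]
    exact hdes p hp
  · intro x hx z hz hxz
    obtain ⟨i, -, rfl⟩ := Finset.mem_image.1 hx
    obtain ⟨j, -, rfl⟩ := Finset.mem_image.1 hz
    exact hsep i j fun hij => hxz (by rw [hij])
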